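/- arXiv:2312.03830 — 7 statements merged into one kernel-verified Lean document; each statement's English description precedes it below -/
import Mathlib

section
/- Let A be a d₁×d₁ Hermitian complex matrix, B a d₂×d₂ Hermitian complex matrix, and Φ a Hermiticity-preserving linear map from d₁×d₁ to d₂×d₂ complex matrices. Let X, Z be d₁×d₁ positive semidefinite matrices and W, Y be d₂×d₂ positive semidefinite matrices. Then Re Tr[A·X] − ‖Y‖₂ · ‖B − Φ(X) − W‖₂ ≤ Re Tr[B·Y] + ‖X‖₂ · ‖Φ†(Y) − A − Z‖₂. -/
open Matrix Filter
open scoped ComplexOrder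

noncomputable section

/-- The Hilbert–Schmidt (Frobenius) norm of a complex matrix. -/
def hsNorm {ι : Type*} [Fintype ι] (M : Matrix ι ι ℂ) : ℝ :=
  Real.sqrt ((Mᴴ * M).trace.re)

lemma neg_hsNorm_mul_hsNorm_le_re_trace {ι : Type*} [Fintype ι] (M N : Matrix ι ι ℂ) :
    -(hsNorm M * hsNorm N) ≤ ((Mᴴ * N).trace).re := by
  let v (M : Matrix ι ι ℂ) : EuclideanSpace ℂ (ι × ι) := WithLp.toLp 2 fun p => M p.1 p.2
  have inner_eq (M N : Matrix ι ι ℂ) : inner ℂ (v M) (v N) = (Mᴴ * N).trace := by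
    simp only [v, PiLp.inner_apply, Fintype.sum_prod_type, trace, diag, mul_apply,
      conjTranspose_apply, RCLike.inner_apply, starRingEnd_apply]
    rw [Finset.sum_comm]
    simp only [mul_comm]
  have norm_eq (M : Matrix ι ι ℂ) : hsNorm M = ‖v M‖ := by
    rw [hsNorm, ← inner_eq, @norm_eq_sqrt_re_inner ℂ]
    rfl
  rw [norm_eq, norm_eq, ← inner_eq]
  exact neg_le_of_abs_le ((Complex.abs_re_le_norm _).trans (norm_inner_le_norm _ _))

lemma re_trace_mul_nonneg {ι : Type*} [Fintype ι] {M N : Matrix ι ι ℂ}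
    (hM : M.PosSemidef) (hN : N.PosSemidef) : 0 ≤ ((M * N).trace).re := by
  classical
  open scoped MatrixOrder Matrix.Norms.L2Operator in
  obtain ⟨C, rfl⟩ := CStarAlgebra.nonneg_iff_eq_star_mul_self.mp hM.nonneg
  rw [Matrix.mul_assoc, trace_mul_comm]
  exact (Complex.le_def.mp (hN.mul_mul_conjTranspose_same C).trace_nonneg).1

theorem approx_weak_duality (d₁ d₂ : ℕ)
    (A : Matrix (Fin d₁) (Fin d₁) ℂ) (hA : A.IsHermitian)
    (B : Matrix (Fin d₂) (Fin d₂) ℂ) (hB : B.IsHermitian)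
    (Φ : Matrix (Fin d₁) (Fin d₁) ℂ →ₗ[ℂ] Matrix (Fin d₂) (Fin d₂) ℂ)
    (hΦ : ∀ X, X.IsHermitian → (Φ X).IsHermitian)
    (Φd : Matrix (Fin d₂) (Fin d₂) ℂ →ₗ[ℂ] Matrix (Fin d₁) (Fin d₁) ℂ)
    (hΦd : ∀ (X : Matrix (Fin d₁) (Fin d₁) ℂ) (Y : Matrix (Fin d₂) (Fin d₂) ℂ),
      (Yᴴ * Φ X).trace = ((Φd Y)ᴴ * X).trace)
    (X Z : Matrix (Fin d₁) (Fin d₁) ℂ) (hX : X.PosSemidef) (hZ : Z.PosSemidef)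
    (W Y : Matrix (Fin d₂) (Fin d₂) ℂ) (hW : W.PosSemidef) (hY : Y.PosSemidef) :
    ((A * X).trace).re - hsNorm Y * hsNorm (B - Φ X - W)
      ≤ ((B * Y).trace).re + hsNorm X * hsNorm (Φd Y - A - Z) := by
  have hYW := re_trace_mul_nonneg hY hW
  have hXZ := re_trace_mul_nonneg hX hZ
  have hY_bound := neg_hsNorm_mul_hsNorm_le_re_trace Y (B - Φ X - W)
  have hX_bound := neg_hsNorm_mul_hsNorm_le_re_trace X (Φd Y - A - Z)
  have hadj : ((Y * Φ X).trace).re = ((X * Φd Y).trace).re := by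
    have h := hΦd X Y
    rw [hY.isHermitian.eq] at h
    rw [h, ← Complex.conj_re, starRingEnd_apply, ← trace_conjTranspose, conjTranspose_mul,
      conjTranspose_conjTranspose, hX.isHermitian.eq]
  rw [hY.isHermitian.eq, Matrix.mul_sub, Matrix.mul_sub, trace_sub, trace_sub, Complex.sub_re,
    Complex.sub_re] at hY_bound
  rw [hX.isHermitian.eq, Matrix.mul_sub, Matrix.mul_sub, trace_sub, trace_sub, Complex.sub_re,
    Complex.sub_re] at hX_bound
  rw [trace_mul_comm A, trace_mul_comm B]
  linarith
end
end

section
/- Let ρ and σ be 2^n×2^n density matrices. Define, for each c > 0, g(c) = sInf {λ + c·‖λω − ρ + σ − μτ‖₂² : λ ≥ 0, μ ≥ 0, ω and τ are 2^n×2^n density matrices}. Then lim_{c→∞} g(c) = sInf {Re Tr[Y] : Y a 2^n×2^n positive semidefinite matrix with Y − (ρ − σ) positive semidefinite}. -/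
open Matrix Filter
open scoped ComplexOrder

noncomputable section

theorem sq_hsNorm {ι : Type*} [Fintype ι] (M : Matrix ι ι ℂ) :
    hsNorm M ^ 2 = ((Mᴴ * M).trace).re :=
  Real.sq_sqrt (Complex.nonneg_iff.mp (posSemidef_conjTranspose_mul_self M).trace_nonneg).1

theorem hsNorm_nonneg {ι : Type*} [Fintype ι] (M : Matrix ι ι ℂ) : 0 ≤ hsNorm M :=
  Real.sqrt_nonneg _

theorem sq_hsNorm_eq_sum_sq_eigenvalues {ι : Type*} [Fintype ι] [DecidableEq ι]
    {E : Matrix ι ι ℂ} (hE : E.IsHermitian) :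
    hsNorm E ^ 2 = ∑ i, hE.eigenvalues i ^ 2 := by
  have hs : E * E = Unitary.conjStarAlgAut ℂ _ hE.eigenvectorUnitary
      (diagonal (RCLike.ofReal ∘ hE.eigenvalues) * diagonal (RCLike.ofReal ∘ hE.eigenvalues)) := by
    rw [map_mul, ← hE.spectral_theorem]
  rw [sq_hsNorm, hE.eq, hs, Unitary.conjStarAlgAut_apply, trace_mul_comm, ← mul_assoc]
  simp [trace_diagonal, sq]

theorem Matrix.IsHermitian.posSemidef_add_hsNorm_smul_one {ι : Type*} [Fintype ι] [DecidableEq ι]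
    {E : Matrix ι ι ℂ} (hE : E.IsHermitian) :
    (E + hsNorm E • (1 : Matrix ι ι ℂ)).PosSemidef := by
  have hs : E + hsNorm E • (1 : Matrix ι ι ℂ) = hE.eigenvectorUnitary.1 *
      diagonal (fun i => ((hE.eigenvalues i + hsNorm E : ℝ) : ℂ)) *
      (hE.eigenvectorUnitary.1)ᴴ := by
    have hd : diagonal (fun i => ((hE.eigenvalues i + hsNorm E : ℝ) : ℂ)) =
        diagonal (RCLike.ofReal ∘ hE.eigenvalues) + hsNorm E • (1 : Matrix ι ι ℂ) := by
      ext i j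
      by_cases hij : i = j
      · subst hij; simp
      · simp [hij]
    have hU : hE.eigenvectorUnitary.1 * (hE.eigenvectorUnitary.1)ᴴ = 1 :=
      Unitary.mul_star_self_of_mem hE.eigenvectorUnitary.2
    have hspec := hE.spectral_theorem
    rw [Unitary.conjStarAlgAut_apply] at hspec
    rw [hd, mul_add, add_mul, mul_smul_comm, smul_mul_assoc, mul_one, hU]
    exact congrArg (· + _) hspec
  rw [hs]
  refine PosSemidef.mul_mul_conjTranspose_same (PosSemidef.diagonal fun i => ?_) _
  have hi : hE.eigenvalues i ^ 2 ≤ hsNorm E ^ 2 := by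
    rw [sq_hsNorm_eq_sum_sq_eigenvalues hE]
    exact Finset.single_le_sum (f := fun i => hE.eigenvalues i ^ 2)
      (fun j _ => sq_nonneg _) (Finset.mem_univ i)
  have := (abs_le_of_sq_le_sq' hi (hsNorm_nonneg E)).1
  exact Complex.zero_le_real.mpr (by linarith)

theorem Matrix.PosSemidef.exists_eq_smul_trace_eq_one {ι : Type*} [Fintype ι]
    {Y : Matrix ι ι ℂ} (hY : Y.PosSemidef) {ρ : Matrix ι ι ℂ} (hρ : ρ.PosSemidef ∧ ρ.trace = 1) :
    ∃ ω : Matrix ι ι ℂ, (ω.PosSemidef ∧ ω.trace = 1) ∧ Y.trace.re • ω = Y := by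
  obtain ⟨hre, him⟩ := Complex.nonneg_iff.mp hY.trace_nonneg
  have htr : Y.trace = (Y.trace.re : ℂ) := Complex.ext rfl (by simp [← him])
  by_cases h : Y.trace.re = 0
  · refine ⟨ρ, hρ, ?_⟩
    rw [h, Complex.ofReal_zero, hY.trace_eq_zero_iff] at htr
    simp [htr]
  · refine ⟨Y.trace.re⁻¹ • Y, ⟨hY.smul (inv_nonneg.mpr hre), ?_⟩, smul_inv_smul₀ h Y⟩
    rw [trace_smul, Complex.real_smul]
    nth_rw 2 [htr]
    rw [← Complex.ofReal_mul, inv_mul_cancel₀ h, Complex.ofReal_one]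

theorem trace_distance_dual_qslack (n : ℕ)
    (ρ σ : Matrix (Fin (2^n)) (Fin (2^n)) ℂ)
    (hρ : ρ.PosSemidef ∧ ρ.trace = 1) (hσ : σ.PosSemidef ∧ σ.trace = 1) :
    Tendsto (fun c : ℝ =>
        sInf {v : ℝ | ∃ (lam mu : ℝ) (ω τ : Matrix (Fin (2^n)) (Fin (2^n)) ℂ),
          0 ≤ lam ∧ 0 ≤ mu ∧
          (ω.PosSemidef ∧ ω.trace = 1) ∧ (τ.PosSemidef ∧ τ.trace = 1) ∧
          v = lam + c * (hsNorm (lam • ω - ρ + σ - mu • τ))^2})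
      atTop
      (nhds (sInf {v : ℝ | ∃ Y : Matrix (Fin (2^n)) (Fin (2^n)) ℂ,
        Y.PosSemidef ∧ (Y - (ρ - σ)).PosSemidef ∧ v = Y.trace.re})) := by
  set D := ρ - σ with hD
  set S : Set ℝ := {v : ℝ | ∃ Y : Matrix (Fin (2^n)) (Fin (2^n)) ℂ,
    Y.PosSemidef ∧ (Y - D).PosSemidef ∧ v = Y.trace.re}
  have hSbdd : BddBelow S := by
    refine ⟨0, ?_⟩
    rintro v ⟨Y, hY, -, rfl⟩
    exact (Complex.nonneg_iff.mp hY.trace_nonneg).1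
  have hSne : S.Nonempty :=
    ⟨_, ρ, hρ.1, by simpa [hD] using hσ.1, rfl⟩
  set N : ℝ := (2 : ℝ) ^ n with hN
  have lower : ∀ c : ℝ, 0 < c → ∀ (lam mu : ℝ) (ω τ : Matrix (Fin (2^n)) (Fin (2^n)) ℂ),
      0 ≤ lam → 0 ≤ mu → (ω.PosSemidef ∧ ω.trace = 1) → (τ.PosSemidef ∧ τ.trace = 1) →
      sInf S - N ^ 2 / 4 * c⁻¹ ≤ lam + c * (hsNorm (lam • ω - ρ + σ - mu • τ))^2 := by
    intro c hc lam mu ω τ hlam hmu hω hτ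
    have hE : (lam • ω - ρ + σ - mu • τ).IsHermitian :=
      (((hω.1.smul hlam).isHermitian.sub hρ.1.isHermitian).add hσ.1.isHermitian).sub
        (hτ.1.smul hmu).isHermitian
    have hpsd := hE.posSemidef_add_hsNorm_smul_one
    set e := hsNorm (lam • ω - ρ + σ - mu • τ)
    have he : 0 ≤ e := hsNorm_nonneg _
    have hmem : lam + N * e ∈ S := by
      refine ⟨lam • ω + e • 1, (hω.1.smul hlam).add (PosSemidef.one.smul he), ?_, ?_⟩
      · have := hpsd.add (hτ.1.smul hmu)
        convert this using 1
        rw [hD]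
        abel
      · simp [trace_add, trace_smul, hω.2, hN]
        norm_cast
        exact mul_comm _ _
    have h1 := csInf_le hSbdd hmem
    have h2 : N * e ≤ c * e ^ 2 + N ^ 2 / 4 * c⁻¹ := by
      have : c * e ^ 2 + N ^ 2 / 4 * c⁻¹ - N * e = c * (e - N / (2 * c)) ^ 2 := by
        field_simp
        ring
      have : 0 ≤ c * (e - N / (2 * c)) ^ 2 := by positivity
      linarith
    linarith
  have hlim : Tendsto (fun c : ℝ => sInf S - N ^ 2 / 4 * c⁻¹) atTop (nhds (sInf S)) := by
    simpa using (tendsto_inv_atTop_zero.const_mul (N ^ 2 / 4)).const_sub (sInf S)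
  refine tendsto_of_tendsto_of_tendsto_of_le_of_le' hlim tendsto_const_nhds ?_ ?_
  · filter_upwards [eventually_gt_atTop 0] with c hc
    refine le_csInf ⟨_, 0, 0, ρ, ρ, le_rfl, le_rfl, hρ, hρ, rfl⟩ ?_
    rintro v ⟨lam, mu, ω, τ, hlam, hmu, hω, hτ, rfl⟩
    exact lower c hc lam mu ω τ hlam hmu hω hτ
  · filter_upwards [eventually_gt_atTop 0] with c hc
    refine le_csInf hSne ?_
    rintro v ⟨Y, hY, hYD, rfl⟩
    refine csInf_le ⟨sInf S - N ^ 2 / 4 * c⁻¹, ?_⟩ ?_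
    · rintro v ⟨lam, mu, ω, τ, hlam, hmu, hω, hτ, rfl⟩
      exact lower c hc lam mu ω τ hlam hmu hω hτ
    · obtain ⟨ω, hω, hωY⟩ := hY.exists_eq_smul_trace_eq_one hρ
      obtain ⟨τ, hτ, hτY⟩ := hYD.exists_eq_smul_trace_eq_one hρ
      refine ⟨_, _, ω, τ, (Complex.nonneg_iff.mp hY.trace_nonneg).1,
        (Complex.nonneg_iff.mp hYD.trace_nonneg).1, hω, hτ, ?_⟩
      have h0 : Y - ρ + σ - (Y - D) = 0 := by
        rw [hD]
        abel
      rw [hωY, hτY, h0]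
      simp [hsNorm]
end
end

section
/- Let ρ and σ be 2^n×2^n density matrices. For λ, μ, ν ≥ 0, 2^n×2^n density matrices ω, τ, and a 2^{n+1}×2^{n+1} density matrix ξ, define g(λ,μ,ν,ω,τ,ξ) = λ² Tr[ω²] + μ² Tr[τ²] + 2^{n+1} + ν² Tr[ξ²] − 2λν Tr[(|0⟩⟨0| ⊗ ω)ξ] − 2μν Tr[(|1⟩⟨1| ⊗ τ)ξ] − 2ν Tr[(σ₁ ⊗ I)ξ]. Then lim_{c→∞} sInf {(1/2)λ Tr[ωρ] + (1/2)μ Tr[τσ] + c·g(λ,μ,ν,ω,τ,ξ) : λ, μ, ν ≥ 0, ω, τ 2^n×2^n density matrices, ξ a 2^{n+1}×2^{n+1} density matrix} = (1/2)·sInf {Re Tr[Yρ] + Re Tr[Zσ] : Y, Z 2^n×2^n positive semidefinite matrices such that the 2×2 block matrix with blocks [Y, I; I, Z] is positive semidefinite}. -/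
open Matrix Filter
open scoped ComplexOrder Kronecker

noncomputable section

/-- The single-qubit Pauli X matrix. -/
def pauliX : Matrix (Fin 2) (Fin 2) ℂ := !![0, 1; 1, 0]

/-- |0⟩⟨0| as a 2×2 matrix. -/
def ket0bra0 : Matrix (Fin 2) (Fin 2) ℂ := !![1, 0; 0, 0]

/-- |1⟩⟨1| as a 2×2 matrix. -/
def ket1bra1 : Matrix (Fin 2) (Fin 2) ℂ := !![0, 0; 0, 1]

/-- The block matrix `[Y, 1; 1, Z]`, indexed by `Fin 2 × m`. -/
def qubitBlock {m : Type*} [DecidableEq m] (Y Z : Matrix m m ℂ) :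
    Matrix (Fin 2 × m) (Fin 2 × m) ℂ :=
  ket0bra0 ⊗ₖ Y + ket1bra1 ⊗ₖ Z + pauliX ⊗ₖ (1 : Matrix m m ℂ)

lemma qubitBlock_submatrix {m : Type*} [DecidableEq m] (Y Z : Matrix m m ℂ) :
    (qubitBlock Y Z).submatrix (Sum.elim (fun i => (0, i)) (fun i => (1, i)))
      (Sum.elim (fun i => (0, i)) (fun i => (1, i))) = fromBlocks Y 1 1 Z := by
  ext (i | i) (j | j) <;> simp [qubitBlock, ket0bra0, ket1bra1, pauliX]

lemma fromBlocks_submatrix_eq_qubitBlock {m : Type*} [DecidableEq m] (Y Z : Matrix m m ℂ) :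
    (fromBlocks Y 1 1 Z).submatrix
      (fun p : Fin 2 × m => if p.1 = 0 then Sum.inl p.2 else Sum.inr p.2)
      (fun p : Fin 2 × m => if p.1 = 0 then Sum.inl p.2 else Sum.inr p.2) = qubitBlock Y Z := by
  ext ⟨a, i⟩ ⟨b, j⟩
  fin_cases a <;> fin_cases b <;> simp [qubitBlock, ket0bra0, ket1bra1, pauliX]

lemma posSemidef_qubitBlock_iff {m : Type*} [DecidableEq m] (Y Z : Matrix m m ℂ) :
    (qubitBlock Y Z).PosSemidef ↔ (fromBlocks Y 1 1 Z).PosSemidef := by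
  constructor <;> intro h
  · rw [← qubitBlock_submatrix]
    exact h.submatrix _
  · rw [← fromBlocks_submatrix_eq_qubitBlock]
    exact h.submatrix _

/-- Shifting a Hermitian matrix by a bound on its Frobenius norm makes it positive semidefinite. -/
lemma Matrix.IsHermitian.posSemidef_add_smul_one {m : Type*} [Fintype m] [DecidableEq m]
    {R : Matrix m m ℂ} (hR : R.IsHermitian) {δ : ℝ} (hδ : 0 ≤ δ)
    (h : (R * R).trace.re ≤ δ ^ 2) : (R + (δ : ℂ) • (1 : Matrix m m ℂ)).PosSemidef := by
  have hsum : (R * R).trace.re = ∑ i, hR.eigenvalues i ^ 2 := by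
    have hs := hR.spectral_theorem
    rw [Unitary.conjStarAlgAut_apply] at hs
    set U := hR.eigenvectorUnitary
    have hU : (star (U : Matrix m m ℂ)) * U = 1 := Unitary.coe_star_mul_self U
    have : R * R = (U : Matrix m m ℂ) * (diagonal (RCLike.ofReal ∘ hR.eigenvalues) *
        diagonal (RCLike.ofReal ∘ hR.eigenvalues)) * star (U : Matrix m m ℂ) := by
      conv_lhs => rw [hs]
      simp only [Matrix.mul_assoc]
      rw [← Matrix.mul_assoc (star (U : Matrix m m ℂ)) (U : Matrix m m ℂ), hU, Matrix.one_mul]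
    rw [this, trace_mul_cycle, hU, Matrix.one_mul, diagonal_mul_diagonal, trace_diagonal]
    simp [pow_two]
  have heig : ∀ i, 0 ≤ hR.eigenvalues i + δ := by
    intro i
    have h1 : hR.eigenvalues i ^ 2 ≤ ∑ i, hR.eigenvalues i ^ 2 :=
      Finset.single_le_sum (f := fun i => hR.eigenvalues i ^ 2)
        (fun i _ => sq_nonneg _) (Finset.mem_univ i)
    have h2 := abs_le_of_sq_le_sq' (h1.trans (hsum ▸ h)) hδ
    linarith [h2.1]
  have hs := hR.spectral_theorem
  rw [Unitary.conjStarAlgAut_apply] at hs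
  set U := hR.eigenvectorUnitary
  have hU : (U : Matrix m m ℂ) * star (U : Matrix m m ℂ) = 1 := Unitary.coe_mul_star_self U
  have key : R + (δ : ℂ) • (1 : Matrix m m ℂ) =
      (U : Matrix m m ℂ) * diagonal (fun i => ((hR.eigenvalues i + δ : ℝ) : ℂ)) * (U : Matrix m m ℂ)ᴴ := by
    have hd : diagonal (fun i => ((hR.eigenvalues i + δ : ℝ) : ℂ)) =
        diagonal (RCLike.ofReal ∘ hR.eigenvalues) + (δ : ℂ) • (1 : Matrix m m ℂ) := by
      ext i j
      by_cases hij : i = j <;> simp [hij]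
    rw [hd, Matrix.mul_add, Matrix.add_mul, Matrix.mul_smul, Matrix.smul_mul, Matrix.mul_one,
      ← star_eq_conjTranspose, hU, ← hs]
  rw [key]
  refine PosSemidef.mul_mul_conjTranspose_same (posSemidef_diagonal_iff.2 fun i => ?_) _
  exact_mod_cast heig i

open scoped MatrixOrder Matrix.Norms.L2Operator in
lemma Matrix.PosSemidef.trace_mul_re_nonneg {m : Type*} [Fintype m]
    {A B : Matrix m m ℂ} (hA : A.PosSemidef) (hB : B.PosSemidef) :
    0 ≤ (A * B).trace.re := by
  classical
  obtain ⟨C, rfl⟩ := CStarAlgebra.nonneg_iff_eq_star_mul_self.mp hB.nonneg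
  rw [star_eq_conjTranspose, ← Matrix.mul_assoc, trace_mul_comm, ← Matrix.mul_assoc]
  exact (Complex.le_def.1 (hA.mul_mul_conjTranspose_same C).trace_nonneg).1

/-- Every positive semidefinite matrix is a nonnegative multiple of a density matrix. -/
lemma Matrix.PosSemidef.exists_eq_smul_density {m : Type*} [Fintype m] [DecidableEq m] [Nonempty m]
    {A : Matrix m m ℂ} (hA : A.PosSemidef) :
    ∃ (t : ℝ) (ω : Matrix m m ℂ), 0 ≤ t ∧ (ω.PosSemidef ∧ ω.trace = 1) ∧ A = (t : ℂ) • ω := by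
  obtain ⟨h0, him⟩ := Complex.le_def.1 hA.trace_nonneg
  have htr : A.trace = (A.trace.re : ℂ) := Complex.ext rfl (by simpa using him.symm)
  have hreal : ∀ {s : ℝ}, 0 ≤ s → (0 : ℂ) ≤ (s : ℂ) := fun hs => by exact_mod_cast hs
  rcases eq_or_ne A 0 with rfl | hne
  · refine ⟨0, (((Fintype.card m : ℝ)⁻¹ : ℝ) : ℂ) • 1, le_rfl,
      ⟨PosSemidef.one.smul (hreal (by positivity)), ?_⟩, by simp⟩
    simp [trace_smul]
  · have ht : A.trace ≠ 0 := fun h => hne (hA.trace_eq_zero_iff.1 h)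
    refine ⟨A.trace.re, ((A.trace.re⁻¹ : ℝ) : ℂ) • A, h0,
      ⟨hA.smul (hreal (inv_nonneg.2 h0)), ?_⟩, ?_⟩
    · rw [trace_smul, Complex.ofReal_inv, ← htr, smul_eq_mul, inv_mul_cancel₀ ht]
    · rw [smul_smul, Complex.ofReal_inv, ← htr, mul_inv_cancel₀ ht, one_smul]

/-- The penalty term is the squared Frobenius distance between the block matrix and its slack. -/
lemma trace_sq_qubitBlock_sub {m : Type*} [Fintype m] [DecidableEq m] (lam mu nu : ℝ)
    (ω τ : Matrix m m ℂ) (ξ : Matrix (Fin 2 × m) (Fin 2 × m) ℂ) :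
    ((qubitBlock ((lam : ℂ) • ω) ((mu : ℂ) • τ) - (nu : ℂ) • ξ) *
      (qubitBlock ((lam : ℂ) • ω) ((mu : ℂ) • τ) - (nu : ℂ) • ξ)).trace.re =
    lam^2 * ((ω * ω).trace.re) + mu^2 * ((τ * τ).trace.re)
      + 2 * (Fintype.card m : ℝ) + nu^2 * ((ξ * ξ).trace.re)
      - 2 * lam * nu * (((ket0bra0 ⊗ₖ ω) * ξ).trace.re)
      - 2 * mu * nu * (((ket1bra1 ⊗ₖ τ) * ξ).trace.re)
      - 2 * nu * (((pauliX ⊗ₖ (1 : Matrix m m ℂ)) * ξ).trace.re) := by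
  have h1 := trace_mul_comm ξ (ket0bra0 ⊗ₖ ω)
  have h2 := trace_mul_comm ξ (ket1bra1 ⊗ₖ τ)
  have h3 := trace_mul_comm ξ (pauliX ⊗ₖ (1 : Matrix m m ℂ))
  simp only [qubitBlock, kronecker_smul, Matrix.mul_sub, Matrix.sub_mul, Matrix.mul_add,
    Matrix.add_mul, Matrix.smul_mul, Matrix.mul_smul, trace_add, trace_sub, trace_smul,
    ← mul_kronecker_mul, trace_kronecker, h1, h2, h3]
  simp [ket0bra0, ket1bra1, pauliX, trace_fin_two]
  ring

lemma isHermitian_qubitBlock {m : Type*} [DecidableEq m] {Y Z : Matrix m m ℂ}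
    (hY : Y.IsHermitian) (hZ : Z.IsHermitian) : (qubitBlock Y Z).IsHermitian := by
  rw [← fromBlocks_submatrix_eq_qubitBlock]
  exact (IsHermitian.fromBlocks hY (by simp) hZ).submatrix _

lemma qubitBlock_add_smul_one {m : Type*} [DecidableEq m] (Y Z : Matrix m m ℂ) (δ : ℂ) :
    qubitBlock (Y + δ • 1) (Z + δ • 1) = qubitBlock Y Z + δ • 1 := by
  ext ⟨a, i⟩ ⟨b, j⟩
  fin_cases a <;> fin_cases b <;>
    simp [qubitBlock, ket0bra0, ket1bra1, pauliX, one_apply]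

theorem root_fidelity_dual_qslack (n : ℕ)
    (ρ σ : Matrix (Fin n → Fin 2) (Fin n → Fin 2) ℂ)
    (hρ : ρ.PosSemidef ∧ ρ.trace = 1) (hσ : σ.PosSemidef ∧ σ.trace = 1) :
    Tendsto (fun c : ℝ =>
        sInf {v : ℝ | ∃ (lam mu nu : ℝ)
            (ω τ : Matrix (Fin n → Fin 2) (Fin n → Fin 2) ℂ)
            (ξ : Matrix (Fin 2 × (Fin n → Fin 2)) (Fin 2 × (Fin n → Fin 2)) ℂ),
          0 ≤ lam ∧ 0 ≤ mu ∧ 0 ≤ nu ∧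
          (ω.PosSemidef ∧ ω.trace = 1) ∧ (τ.PosSemidef ∧ τ.trace = 1) ∧
          (ξ.PosSemidef ∧ ξ.trace = 1) ∧
          v = (1/2) * lam * ((ω * ρ).trace.re) + (1/2) * mu * ((τ * σ).trace.re)
            + c * (lam^2 * ((ω * ω).trace.re) + mu^2 * ((τ * τ).trace.re)
              + (2:ℝ)^(n+1) + nu^2 * ((ξ * ξ).trace.re)
              - 2 * lam * nu * (((ket0bra0 ⊗ₖ ω) * ξ).trace.re)
              - 2 * mu * nu * (((ket1bra1 ⊗ₖ τ) * ξ).trace.re)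
              - 2 * nu * (((pauliX ⊗ₖ (1 : Matrix (Fin n → Fin 2) (Fin n → Fin 2) ℂ))
                  * ξ).trace.re))})
      atTop
      (nhds ((1/2) * sInf {v : ℝ |
        ∃ Y Z : Matrix (Fin n → Fin 2) (Fin n → Fin 2) ℂ,
        Y.PosSemidef ∧ Z.PosSemidef ∧
        (Matrix.fromBlocks Y 1 1 Z).PosSemidef ∧
        v = ((Y * ρ).trace.re) + ((Z * σ).trace.re)})) := by
  have hreal : ∀ {s : ℝ}, 0 ≤ s → (0 : ℂ) ≤ (s : ℂ) := fun hs => by exact_mod_cast hs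
  set D : Set ℝ := {v : ℝ | ∃ Y Z : Matrix (Fin n → Fin 2) (Fin n → Fin 2) ℂ,
    Y.PosSemidef ∧ Z.PosSemidef ∧ (Matrix.fromBlocks Y 1 1 Z).PosSemidef ∧
    v = ((Y * ρ).trace.re) + ((Z * σ).trace.re)}
  have hD_bdd : BddBelow D := by
    refine ⟨0, ?_⟩
    rintro v ⟨Y, Z, hY, hZ, -, rfl⟩
    exact add_nonneg (hY.trace_mul_re_nonneg hρ.1) (hZ.trace_mul_re_nonneg hσ.1)
  have hcard : (2 : ℝ) ^ (n + 1) = 2 * (Fintype.card (Fin n → Fin 2) : ℝ) := by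
    simp [pow_succ, mul_comm]
  simp only [hcard, ← trace_sq_qubitBlock_sub]
  have hshift : ∀ (Y Z : Matrix (Fin n → Fin 2) (Fin n → Fin 2) ℂ)
      (W : Matrix (Fin 2 × (Fin n → Fin 2)) (Fin 2 × (Fin n → Fin 2)) ℂ) (δ : ℝ),
      Y.PosSemidef → Z.PosSemidef → W.PosSemidef → 0 ≤ δ →
      ((qubitBlock Y Z - W) * (qubitBlock Y Z - W)).trace.re ≤ δ ^ 2 →
      sInf D ≤ (Y * ρ).trace.re + (Z * σ).trace.re + 2 * δ := by
    intro Y Z W δ hY hZ hW hδ h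
    have hR := ((isHermitian_qubitBlock hY.1 hZ.1).sub hW.1).posSemidef_add_smul_one hδ h
    have hδ1 : ((δ : ℂ) • (1 : Matrix (Fin n → Fin 2) (Fin n → Fin 2) ℂ)).PosSemidef :=
      PosSemidef.one.smul (hreal hδ)
    refine csInf_le hD_bdd ⟨Y + (δ : ℂ) • 1, Z + (δ : ℂ) • 1, hY.add hδ1, hZ.add hδ1, ?_, ?_⟩
    · rw [← posSemidef_qubitBlock_iff, qubitBlock_add_smul_one]
      convert hR.add hW using 1
      abel
    · simp only [Matrix.add_mul, Matrix.smul_mul, Matrix.one_mul, trace_add, trace_smul, hρ.2,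
        hσ.2, Complex.add_re, smul_eq_mul, mul_one, Complex.ofReal_re]
      ring
  have hD_ne : D.Nonempty := by
    have h : (qubitBlock (1 : Matrix (Fin n → Fin 2) (Fin n → Fin 2) ℂ) 1).PosSemidef := by
      rw [posSemidef_qubitBlock_iff]
      simpa [fromBlocks_conjTranspose, fromBlocks_multiply] using posSemidef_conjTranspose_mul_self
        (fromBlocks (1 : Matrix (Fin n → Fin 2) (Fin n → Fin 2) ℂ) 1 0
          (0 : Matrix (Fin n → Fin 2) (Fin n → Fin 2) ℂ))
    exact ⟨_, 1, 1, PosSemidef.one, PosSemidef.one, (posSemidef_qubitBlock_iff _ _).1 h, rfl⟩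
  have hmem : ∀ c : ℝ, ∀ v ∈ D, ∃ (lam mu nu : ℝ)
      (ω τ : Matrix (Fin n → Fin 2) (Fin n → Fin 2) ℂ)
      (ξ : Matrix (Fin 2 × (Fin n → Fin 2)) (Fin 2 × (Fin n → Fin 2)) ℂ),
      0 ≤ lam ∧ 0 ≤ mu ∧ 0 ≤ nu ∧ (ω.PosSemidef ∧ ω.trace = 1) ∧ (τ.PosSemidef ∧ τ.trace = 1) ∧
      (ξ.PosSemidef ∧ ξ.trace = 1) ∧
      1 / 2 * v = (1/2) * lam * ((ω * ρ).trace.re) + (1/2) * mu * ((τ * σ).trace.re)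
        + c * ((qubitBlock ((lam : ℂ) • ω) ((mu : ℂ) • τ) - (nu : ℂ) • ξ) *
          (qubitBlock ((lam : ℂ) • ω) ((mu : ℂ) • τ) - (nu : ℂ) • ξ)).trace.re := by
    rintro c v ⟨Y, Z, hY, hZ, hYZ, rfl⟩
    obtain ⟨lam, ω, hlam, hω, rfl⟩ := hY.exists_eq_smul_density
    obtain ⟨mu, τ, hmu, hτ, rfl⟩ := hZ.exists_eq_smul_density
    obtain ⟨nu, ξ, hnu, hξ, h⟩ :=
      ((posSemidef_qubitBlock_iff _ _).2 hYZ).exists_eq_smul_density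
    refine ⟨lam, mu, nu, ω, τ, ξ, hlam, hmu, hnu, hω, hτ, hξ, ?_⟩
    rw [h, sub_self]
    simp only [Matrix.smul_mul, trace_smul, smul_eq_mul, Complex.re_ofReal_mul, mul_zero,
      trace_zero, Complex.zero_re]
    ring
  have hlow : ∀ c : ℝ, 0 < c → ∀ (lam mu nu : ℝ)
      (ω τ : Matrix (Fin n → Fin 2) (Fin n → Fin 2) ℂ)
      (ξ : Matrix (Fin 2 × (Fin n → Fin 2)) (Fin 2 × (Fin n → Fin 2)) ℂ),
      0 ≤ lam → 0 ≤ mu → 0 ≤ nu → ω.PosSemidef → τ.PosSemidef → ξ.PosSemidef →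
      1 / 2 * sInf D - 1 / 4 * c⁻¹ ≤
        (1/2) * lam * ((ω * ρ).trace.re) + (1/2) * mu * ((τ * σ).trace.re)
        + c * ((qubitBlock ((lam : ℂ) • ω) ((mu : ℂ) • τ) - (nu : ℂ) • ξ) *
          (qubitBlock ((lam : ℂ) • ω) ((mu : ℂ) • τ) - (nu : ℂ) • ξ)).trace.re := by
    intro c hc lam mu nu ω τ ξ hlam hmu hnu hω hτ hξ
    have hY := hω.smul (hreal hlam)
    have hZ := hτ.smul (hreal hmu)
    have hW := hξ.smul (hreal hnu)
    have hR := (isHermitian_qubitBlock hY.1 hZ.1).sub hW.1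
    have hg : 0 ≤ ((qubitBlock ((lam : ℂ) • ω) ((mu : ℂ) • τ) - (nu : ℂ) • ξ) *
        (qubitBlock ((lam : ℂ) • ω) ((mu : ℂ) • τ) - (nu : ℂ) • ξ)).trace.re := by
      have := (posSemidef_conjTranspose_mul_self
        (qubitBlock ((lam : ℂ) • ω) ((mu : ℂ) • τ) - (nu : ℂ) • ξ)).trace_nonneg
      rw [hR.eq] at this
      exact (Complex.le_def.1 this).1
    have h := hshift _ _ _ _ hY hZ hW (Real.sqrt_nonneg _) (Real.sq_sqrt hg).ge
    have hsq := Real.sq_sqrt hg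
    set δ := √(((qubitBlock ((lam : ℂ) • ω) ((mu : ℂ) • τ) - (nu : ℂ) • ξ) *
        (qubitBlock ((lam : ℂ) • ω) ((mu : ℂ) • τ) - (nu : ℂ) • ξ)).trace.re)
    rw [← hsq]
    simp only [Matrix.smul_mul, trace_smul, smul_eq_mul, Complex.re_ofReal_mul] at h
    have hamgm : 0 ≤ c * δ ^ 2 - δ + 1 / 4 * c⁻¹ := by
      have : c * δ ^ 2 - δ + 1 / 4 * c⁻¹ = c * (δ - 1 / 2 * c⁻¹) ^ 2 := by
        field_simp
        ring
      rw [this]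
      positivity
    linarith
  have hlim : Tendsto (fun c : ℝ => 1 / 2 * sInf D - 1 / 4 * c⁻¹) atTop
      (nhds (1 / 2 * sInf D)) := by
    simpa using tendsto_const_nhds.sub (tendsto_inv_atTop_zero.const_mul (1 / 4 : ℝ))
  refine tendsto_of_tendsto_of_tendsto_of_le_of_le' hlim tendsto_const_nhds ?_ ?_
  · filter_upwards [eventually_gt_atTop 0] with c hc
    obtain ⟨v, hv⟩ := hD_ne
    refine le_csInf ⟨_, hmem c v hv⟩ ?_
    rintro _ ⟨lam, mu, nu, ω, τ, ξ, hlam, hmu, hnu, hω, hτ, hξ, rfl⟩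
    exact hlow c hc lam mu nu ω τ ξ hlam hmu hnu hω.1 hτ.1 hξ.1
  · filter_upwards [eventually_gt_atTop 0] with c hc
    rw [← div_le_iff₀' one_half_pos]
    refine le_csInf hD_ne fun v hv => ?_
    rw [div_le_iff₀' one_half_pos]
    refine csInf_le ⟨1 / 2 * sInf D - 1 / 4 * c⁻¹, ?_⟩ (hmem c v hv)
    rintro _ ⟨lam, mu, nu, ω, τ, ξ, hlam, hmu, hnu, hω, hτ, hξ, rfl⟩
    exact hlow c hc lam mu nu ω τ ξ hlam hmu hnu hω.1 hτ.1 hξ.1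
end
end

section
/- Let n_A, n_B ∈ ℕ, n = n_A + n_B, and let ρ_AB be a 2^n×2^n density matrix on the bipartite system A⊗B. For real coefficient families α⃗ = (α_{x⃗_A,x⃗_B}), β⃗ = (β_{x⃗_A,x⃗_B}), λ, μ ≥ 0, and 2^n×2^n density matrices σ_AB, τ_AB, define g₃(α⃗, β⃗, λ, μ, σ_AB, τ_AB) = 2^{n+1}(Σ α_{x⃗_A,x⃗_B}² + Σ β_{x⃗_A,x⃗_B}²) + Tr[ρ_AB²] + μ² Tr[τ_AB²] − 2 Σ_{x⃗_A,x⃗_B} (−1)^{f(x⃗_B)} (α_{x⃗_A,x⃗_B} − β_{x⃗_A,x⃗_B}) Tr[(σ_{x⃗_A} ⊗ σ_{x⃗_B}) ρ_AB] − 2^{n+1} Σ_{x⃗_A,x⃗_B} α_{x⃗_A,x⃗_B} β_{x⃗_A,x⃗_B} + λ² Tr[σ_AB²] − 2λ Σ_{x⃗_A,x⃗_B} α_{x⃗_A,x⃗_B} Tr[(σ_{x⃗_A} ⊗ σ_{x⃗_B}) σ_AB] − 2μ Σ_{x⃗_A,x⃗_B} β_{x⃗_A,x⃗_B} Tr[(σ_{x⃗_A}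 ⊗ σ_{x⃗_B}) τ_AB], where f(x⃗_B) counts the number of entries of x⃗_B equal to 2. Then lim_{c→∞} sInf {2^n(α_{0⃗,0⃗} + β_{0⃗,0⃗}) + c·g₃(α⃗, β⃗, λ, μ, σ_AB, τ_AB) : α⃗, β⃗ real, λ, μ ≥ 0, σ_AB, τ_AB 2^n×2^n density matrices} = sInf {Re Tr[K + L] : K, L 2^n×2^n positive semidefinite matrices with T_B(K − L) = ρ_AB}. -/
open Matrix Filter
open scoped ComplexOrder Kronecker

noncomputable section

/-- The single-qubit Pauli matrices σ₀ = I, σ₁ = X, σ₂ = Y, σ₃ = Z. -/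
def pauli : Fin 4 → Matrix (Fin 2) (Fin 2) ℂ :=
  ![1, !![0, 1; 1, 0], !![0, -Complex.I; Complex.I, 0], !![1, 0; 0, -1]]

/-- The Pauli string σ_{x⃗} = σ_{x₁} ⊗ ⋯ ⊗ σ_{x_k}, realized entrywise on the
index type `Fin k → Fin 2` of `k`-bit strings. -/
def pauliString {k : ℕ} (x : Fin k → Fin 4) :
    Matrix (Fin k → Fin 2) (Fin k → Fin 2) ℂ :=
  Matrix.of fun a b => ∏ i, pauli (x i) (a i) (b i)

/-- Partial transpose on the second (B) tensor factor of a bipartite matrix. -/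
def ptB {ιA ιB : Type*} (M : Matrix (ιA × ιB) (ιA × ιB) ℂ) :
    Matrix (ιA × ιB) (ιA × ιB) ℂ :=
  Matrix.of fun p q => M (p.1, q.2) (q.1, p.2)

/-- Number of entries of a Pauli index string equal to 2 (i.e., number of σ_Y's). -/
def countY {k : ℕ} (x : Fin k → Fin 4) : ℕ :=
  (Finset.univ.filter fun i => x i = 2).card

open scoped Matrix.Norms.Frobenius

section Frobenius

variable {ι : Type*} [Fintype ι] [DecidableEq ι]

lemma Matrix.IsHermitian.frobenius_norm_sq {M : Matrix ι ι ℂ} (hM : M.IsHermitian) :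
    ‖M‖ ^ 2 = ((M * M).trace).re := by
  rw [frobenius_norm_def, ← Real.sqrt_eq_rpow, Real.sq_sqrt (by positivity)]
  simp only [trace, diag_apply, mul_apply, Complex.re_sum]
  refine Finset.sum_congr rfl fun i _ => Finset.sum_congr rfl fun j _ => ?_
  rw [← hM.apply j i, Complex.star_def, Complex.mul_conj, Complex.ofReal_re,
    Complex.normSq_eq_norm_sq, Real.rpow_two]

lemma Matrix.IsHermitian.add_smul_one_posSemidef {M : Matrix ι ι ℂ} (hM : M.IsHermitian)
    {r : ℝ} (hr : ‖M‖ ≤ r) : (M + (r : ℂ) • (1 : Matrix ι ι ℂ)).PosSemidef := by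
  have h1 : ((r : ℂ) • (1 : Matrix ι ι ℂ)).IsHermitian := by
    simp [IsHermitian, conjTranspose_smul]
  refine .of_dotProduct_mulVec_nonneg (hM.add h1) fun x => ?_
  have him : (star x ⬝ᵥ (M *ᵥ x)).im = 0 := hM.im_star_dotProduct_mulVec_self x
  have hcs : ‖star x ⬝ᵥ (M *ᵥ x)‖ ≤ r * ‖WithLp.toLp 2 x‖ ^ 2 := by
    have h3 : ‖WithLp.toLp 2 (M *ᵥ x)‖ ≤ ‖M‖ * ‖WithLp.toLp 2 x‖ := by
      rw [← frobenius_norm_replicateCol (ι := Unit), ← frobenius_norm_replicateCol (ι := Unit),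
        replicateCol_mulVec]
      exact frobenius_norm_mul _ _
    have h4 : ‖star x ⬝ᵥ (M *ᵥ x)‖ ≤ ‖WithLp.toLp 2 x‖ * ‖WithLp.toLp 2 (M *ᵥ x)‖ := by
      have := norm_inner_le_norm (𝕜 := ℂ) (WithLp.toLp 2 x) (WithLp.toLp 2 (M *ᵥ x))
      rwa [EuclideanSpace.inner_toLp_toLp, dotProduct_comm] at this
    nlinarith [norm_nonneg (WithLp.toLp 2 x), norm_nonneg M]
  have hself : star x ⬝ᵥ x = ((‖WithLp.toLp 2 x‖ ^ 2 : ℝ) : ℂ) := by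
    have := inner_self_eq_norm_sq_to_K (𝕜 := ℂ) (WithLp.toLp 2 x)
    rw [EuclideanSpace.inner_toLp_toLp, dotProduct_comm] at this
    simpa using this
  rw [add_mulVec, dotProduct_add, smul_mulVec, one_mulVec, dotProduct_smul, hself]
  have hre := (abs_le.mp ((Complex.abs_re_le_norm _).trans hcs)).1
  rw [Complex.le_def]
  constructor
  · simp only [Complex.zero_re, Complex.add_re, smul_eq_mul, ← Complex.ofReal_mul,
      Complex.ofReal_re]
    linarith
  · simp only [Complex.zero_im, Complex.add_im, smul_eq_mul, ← Complex.ofReal_mul,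
      Complex.ofReal_im, him, add_zero]

lemma Matrix.IsHermitian.neg_trace_re_le {M : Matrix ι ι ℂ} (hM : M.IsHermitian) :
    -(M.trace).re ≤ Fintype.card ι * ‖M‖ := by
  have h := (Complex.le_def.mp (hM.add_smul_one_posSemidef le_rfl).trace_nonneg).1
  simp [trace_add, trace_smul] at h
  linarith

lemma Matrix.IsHermitian.trace_re_le {M : Matrix ι ι ℂ} (hM : M.IsHermitian) :
    (M.trace).re ≤ Fintype.card ι * ‖M‖ := by
  simpa using hM.neg.neg_trace_re_le

/-- A positive semidefinite matrix is a nonnegative multiple of a density matrix. -/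
lemma Matrix.PosSemidef.exists_smul_density [Nonempty ι] {M : Matrix ι ι ℂ}
    (hM : M.PosSemidef) :
    ∃ (t : ℝ) (D : Matrix ι ι ℂ), 0 ≤ t ∧ (D.PosSemidef ∧ D.trace = 1) ∧ M = (t : ℂ) • D := by
  have hcoe : ((M.trace.re : ℝ) : ℂ) = M.trace :=
    Complex.ext rfl (Complex.le_def.mp hM.trace_nonneg).2
  by_cases h0 : M.trace = 0
  · refine ⟨0, ((Fintype.card ι : ℝ)⁻¹ : ℂ) • 1, le_rfl, ⟨?_, ?_⟩, ?_⟩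
    · refine PosSemidef.one.smul ?_
      rw [← Complex.ofReal_inv]
      exact Complex.zero_le_real.mpr (by positivity)
    · simp [trace_smul]
    · simpa using hM.trace_eq_zero_iff.mp h0
  · have ht : 0 ≤ M.trace.re := (Complex.le_def.mp hM.trace_nonneg).1
    refine ⟨M.trace.re, ((M.trace.re⁻¹ : ℝ) : ℂ) • M, ht, ⟨?_, ?_⟩, ?_⟩
    · exact hM.smul (Complex.zero_le_real.mpr (inv_nonneg.mpr ht))
    · rw [trace_smul, Complex.ofReal_inv, hcoe, smul_eq_mul, inv_mul_cancel₀ h0]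
    · rw [smul_smul, Complex.ofReal_inv, hcoe, mul_inv_cancel₀ h0, one_smul]

end Frobenius

section PartialTranspose

variable {ιA ιB : Type*}

lemma ptB_apply (M : Matrix (ιA × ιB) (ιA × ιB) ℂ) (p q : ιA × ιB) :
    ptB M p q = M (p.1, q.2) (q.1, p.2) := rfl

lemma ptB_ptB (M : Matrix (ιA × ιB) (ιA × ιB) ℂ) : ptB (ptB M) = M := rfl

lemma ptB_sub (M N : Matrix (ιA × ιB) (ιA × ιB) ℂ) : ptB (M - N) = ptB M - ptB N := rfl

lemma Matrix.IsHermitian.ptB {M : Matrix (ιA × ιB) (ιA × ιB) ℂ} (hM : M.IsHermitian) :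
    (ptB M).IsHermitian :=
  IsHermitian.ext fun p q => hM.apply (p.1, q.2) (q.1, p.2)

lemma norm_ptB [Fintype ιA] [Fintype ιB] (M : Matrix (ιA × ιB) (ιA × ιB) ℂ) :
    ‖ptB M‖ = ‖M‖ := by
  rw [frobenius_norm_def, frobenius_norm_def]
  congr 1
  simp only [← Fintype.sum_prod_type']
  exact Fintype.sum_equiv ⟨fun p => ((p.1.1, p.2.2), (p.2.1, p.1.2)),
    fun p => ((p.1.1, p.2.2), (p.2.1, p.1.2)), fun _ => rfl, fun _ => rfl⟩ _ _ fun _ => rfl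

end PartialTranspose

section Pauli

variable {k : ℕ}

lemma pauli_zero : pauli 0 = 1 := rfl

lemma pauli_one : pauli 1 = !![0, 1; 1, 0] := rfl

lemma pauli_two : pauli 2 = !![0, -Complex.I; Complex.I, 0] := rfl

lemma pauli_three : pauli 3 = !![1, 0; 0, -1] := rfl

lemma pauli_isHermitian (x : Fin 4) : (pauli x).IsHermitian := by
  refine IsHermitian.ext fun i j => ?_
  fin_cases x <;> fin_cases i <;> fin_cases j <;> simp [pauli]

lemma pauli_swap (x : Fin 4) (i j : Fin 2) :
    pauli x j i = (if x = 2 then -1 else 1) * pauli x i j := by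
  fin_cases x <;> fin_cases i <;> fin_cases j <;> simp [pauli]

lemma sum_pauli_mul_pauli (x y : Fin 4) :
    ∑ i, ∑ j, pauli x i j * pauli y j i = if x = y then 2 else 0 := by
  fin_cases x <;> fin_cases y <;> norm_num [pauli, Fin.sum_univ_two]

lemma sum_pauli_apply_mul_pauli_apply (i j l m : Fin 2) :
    ∑ x, pauli x i j * pauli x l m = if i = m ∧ j = l then 2 else 0 := by
  fin_cases i <;> fin_cases j <;> fin_cases l <;> fin_cases m <;>
    norm_num [pauli_zero, pauli_one, pauli_two, pauli_three, Fin.sum_univ_four]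

lemma pauliString_isHermitian (x : Fin k → Fin 4) : (pauliString x).IsHermitian := by
  refine IsHermitian.ext fun a b => ?_
  simp [pauliString, star_prod, (pauli_isHermitian _).apply]

lemma pauliString_swap (x : Fin k → Fin 4) (a b : Fin k → Fin 2) :
    pauliString x b a = (-1) ^ countY x * pauliString x a b := by
  simp only [pauliString, of_apply, countY, pauli_swap _ (a _) (b _), Finset.prod_mul_distrib,
    Finset.prod_ite, Finset.prod_const, one_pow, mul_one]

lemma trace_pauliString_mul_pauliString (x y : Fin k → Fin 4) :
    (pauliString x * pauliString y).trace = if x = y then 2 ^ k else 0 := by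
  simp only [trace, diag_apply, mul_apply, pauliString, of_apply, ← Finset.prod_mul_distrib]
  calc ∑ a : Fin k → Fin 2, ∑ b : Fin k → Fin 2,
        ∏ i, pauli (x i) (a i) (b i) * pauli (y i) (b i) (a i)
      = ∑ a : Fin k → Fin 2, ∏ i, ∑ b, pauli (x i) (a i) b * pauli (y i) b (a i) :=
        Finset.sum_congr rfl fun a _ =>
          (Fintype.prod_sum fun i b => pauli (x i) (a i) b * pauli (y i) b (a i)).symm
    _ = ∏ i, ∑ a, ∑ b, pauli (x i) a b * pauli (y i) b a :=
        (Fintype.prod_sum fun i a => ∑ b, pauli (x i) a b * pauli (y i) b a).symm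
    _ = if x = y then 2 ^ k else 0 := by
        simp only [sum_pauli_mul_pauli, Finset.prod_ite_zero, funext_iff, Finset.prod_const,
          Finset.mem_univ, true_implies, Finset.card_univ, Fintype.card_fin]

lemma sum_pauliString_apply_mul_pauliString_apply (a b c d : Fin k → Fin 2) :
    ∑ x, pauliString x a b * pauliString x c d = if a = d ∧ b = c then 2 ^ k else 0 := by
  simp only [pauliString, of_apply, ← Finset.prod_mul_distrib]
  rw [← Fintype.prod_sum fun i x => pauli x (a i) (b i) * pauli x (c i) (d i)]
  simp only [sum_pauli_apply_mul_pauli_apply, Finset.prod_ite_zero, funext_iff, forall_and,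
    Finset.prod_const, Finset.mem_univ, true_implies, Finset.card_univ, Fintype.card_fin]

lemma pauliString_zero : (pauliString fun _ : Fin k => 0) = 1 := by
  ext a b
  simp only [pauliString, pauli_zero, of_apply, one_apply, Finset.prod_ite_zero, funext_iff,
    Finset.prod_const_one, Finset.mem_univ, true_implies]

end Pauli

section PauliPair

variable {nA nB : ℕ}

/-- The bipartite Pauli string σ_{x⃗_A} ⊗ σ_{x⃗_B}. -/
def pauliPair (x : (Fin nA → Fin 4) × (Fin nB → Fin 4)) :
    Matrix ((Fin nA → Fin 2) × (Fin nB → Fin 2)) ((Fin nA → Fin 2) × (Fin nB → Fin 2)) ℂ :=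
  pauliString x.1 ⊗ₖ pauliString x.2

/-- The real linear combination of bipartite Pauli strings with coefficients `a`. -/
def pauliComb (a : (Fin nA → Fin 4) × (Fin nB → Fin 4) → ℝ) :
    Matrix ((Fin nA → Fin 2) × (Fin nB → Fin 2)) ((Fin nA → Fin 2) × (Fin nB → Fin 2)) ℂ :=
  ∑ x, (a x : ℂ) • pauliPair x

lemma pauliPair_apply (x : (Fin nA → Fin 4) × (Fin nB → Fin 4))
    (p q : (Fin nA → Fin 2) × (Fin nB → Fin 2)) :
    pauliPair x p q = pauliString x.1 p.1 q.1 * pauliString x.2 p.2 q.2 := rfl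

lemma pauliPair_isHermitian (x : (Fin nA → Fin 4) × (Fin nB → Fin 4)) :
    (pauliPair x).IsHermitian := by
  rw [IsHermitian, pauliPair, conjTranspose_kronecker, (pauliString_isHermitian _).eq,
    (pauliString_isHermitian _).eq]

lemma trace_pauliPair_mul_pauliPair (x y : (Fin nA → Fin 4) × (Fin nB → Fin 4)) :
    (pauliPair x * pauliPair y).trace = if x = y then 2 ^ (nA + nB) else 0 := by
  rw [pauliPair, pauliPair, ← mul_kronecker_mul, trace_kronecker,
    trace_pauliString_mul_pauliString, trace_pauliString_mul_pauliString, ite_zero_mul_ite_zero,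
    pow_add]
  simp only [Prod.ext_iff]

lemma pauliPair_zero :
    pauliPair ((fun _ => 0, fun _ => 0) : (Fin nA → Fin 4) × (Fin nB → Fin 4)) = 1 := by
  simp only [pauliPair, pauliString_zero, one_kronecker_one]

lemma trace_pauliPair (x : (Fin nA → Fin 4) × (Fin nB → Fin 4)) :
    (pauliPair x).trace = if x = (fun _ => 0, fun _ => 0) then 2 ^ (nA + nB) else 0 := by
  rw [← trace_pauliPair_mul_pauliPair, pauliPair_zero, mul_one]

lemma sum_pauliPair_apply_mul_pauliPair_apply (p q r s : (Fin nA → Fin 2) × (Fin nB → Fin 2)) :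
    ∑ x, pauliPair x p q * pauliPair x r s =
      if p = s ∧ q = r then 2 ^ (nA + nB) else 0 := by
  simp only [pauliPair_apply, Fintype.sum_prod_type, mul_mul_mul_comm]
  rw [← Finset.sum_mul_sum, sum_pauliString_apply_mul_pauliString_apply,
    sum_pauliString_apply_mul_pauliString_apply, ite_zero_mul_ite_zero, pow_add]
  simp only [Prod.ext_iff, and_and_and_comm]

lemma ptB_pauliPair (x : (Fin nA → Fin 4) × (Fin nB → Fin 4)) :
    ptB (pauliPair x) = ((-1) ^ countY x.2 : ℂ) • pauliPair x := by
  ext p q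
  simp only [ptB_apply, pauliPair_apply, Matrix.smul_apply, smul_eq_mul,
    pauliString_swap x.2 p.2 q.2]
  ring

lemma pauliComb_isHermitian (a : (Fin nA → Fin 4) × (Fin nB → Fin 4) → ℝ) :
    (pauliComb a).IsHermitian := by
  simp only [IsHermitian, pauliComb, conjTranspose_sum, conjTranspose_smul,
    (pauliPair_isHermitian _).eq, Complex.star_def, Complex.conj_ofReal]

lemma pauliComb_sub (a b : (Fin nA → Fin 4) × (Fin nB → Fin 4) → ℝ) :
    pauliComb (a - b) = pauliComb a - pauliComb b := by
  simp [pauliComb, sub_smul]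

lemma ptB_pauliComb (a : (Fin nA → Fin 4) × (Fin nB → Fin 4) → ℝ) :
    ptB (pauliComb a) = pauliComb fun x => (-1) ^ countY x.2 * a x := by
  have h : ptB (pauliComb a) = ∑ x, (a x : ℂ) • ptB (pauliPair x) := by
    ext p q
    simp [ptB_apply, pauliComb, Matrix.sum_apply]
  rw [h]
  simp only [ptB_pauliPair, pauliComb, smul_smul, Complex.ofReal_mul, Complex.ofReal_pow,
    Complex.ofReal_neg, Complex.ofReal_one, mul_comm]

lemma trace_pauliComb_mul_re (a : (Fin nA → Fin 4) × (Fin nB → Fin 4) → ℝ)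
    (M : Matrix ((Fin nA → Fin 2) × (Fin nB → Fin 2)) ((Fin nA → Fin 2) × (Fin nB → Fin 2)) ℂ) :
    (pauliComb a * M).trace.re = ∑ x, a x * (pauliPair x * M).trace.re := by
  simp [pauliComb, Finset.sum_mul, trace_sum]

lemma trace_pauliComb_re (a : (Fin nA → Fin 4) × (Fin nB → Fin 4) → ℝ) :
    (pauliComb a).trace.re = 2 ^ (nA + nB) * a (fun _ => 0, fun _ => 0) := by
  have h := trace_pauliComb_mul_re a 1
  simp only [mul_one, trace_pauliPair, apply_ite Complex.re, Complex.zero_re, mul_ite, mul_zero,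
    Finset.sum_ite_eq', Finset.mem_univ, if_true] at h
  rw [h, mul_comm]
  norm_cast

lemma trace_pauliComb_mul_self_re (a : (Fin nA → Fin 4) × (Fin nB → Fin 4) → ℝ) :
    (pauliComb a * pauliComb a).trace.re = 2 ^ (nA + nB) * ∑ x, a x ^ 2 := by
  have h2 : ((2 : ℂ) ^ (nA + nB)).re = 2 ^ (nA + nB) := by norm_cast
  rw [trace_pauliComb_mul_re, Finset.mul_sum]
  refine Finset.sum_congr rfl fun x _ => ?_
  rw [trace_mul_comm, trace_pauliComb_mul_re]
  simp only [trace_pauliPair_mul_pauliPair, apply_ite Complex.re, Complex.zero_re, mul_ite,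
    mul_zero, Finset.sum_ite_eq', Finset.mem_univ, if_true, h2]
  ring

/-- The Pauli strings span the Hermitian matrices over the reals. -/
lemma Matrix.IsHermitian.exists_pauliComb_eq
    {M : Matrix ((Fin nA → Fin 2) × (Fin nB → Fin 2)) ((Fin nA → Fin 2) × (Fin nB → Fin 2)) ℂ}
    (hM : M.IsHermitian) :
    ∃ a : (Fin nA → Fin 4) × (Fin nB → Fin 4) → ℝ, pauliComb a = M := by
  have hreal (x) : (((pauliPair x * M).trace.re : ℝ) : ℂ) = (pauliPair x * M).trace := by
    rw [← Complex.conj_eq_iff_re, ← Complex.star_def, ← trace_conjTranspose, conjTranspose_mul,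
      hM.eq, (pauliPair_isHermitian x).eq, trace_mul_comm]
  refine ⟨fun x => (2 ^ (nA + nB))⁻¹ * (pauliPair x * M).trace.re, ?_⟩
  ext p q
  have h : pauliComb (fun x => (2 ^ (nA + nB))⁻¹ * (pauliPair x * M).trace.re) p q =
      (2 ^ (nA + nB))⁻¹ * ∑ r, ∑ s, M s r * ∑ x, pauliPair x r s * pauliPair x p q := by
    simp only [pauliComb, Matrix.sum_apply, Matrix.smul_apply, smul_eq_mul, Complex.ofReal_mul,
      hreal, Complex.ofReal_inv, Complex.ofReal_pow, Complex.ofReal_ofNat]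
    simp only [trace, diag_apply, mul_apply, Finset.mul_sum, Finset.sum_mul]
    rw [Finset.sum_comm]
    refine Finset.sum_congr rfl fun r _ => ?_
    rw [Finset.sum_comm]
    refine Finset.sum_congr rfl fun s _ => Finset.sum_congr rfl fun x _ => ?_
    ring
  rw [h]
  simp [sum_pauliPair_apply_mul_pauliPair_apply, ite_and, mul_comm]

lemma norm_pauliComb_sub_sq (a : (Fin nA → Fin 4) × (Fin nB → Fin 4) → ℝ)
    {M : Matrix ((Fin nA → Fin 2) × (Fin nB → Fin 2)) ((Fin nA → Fin 2) × (Fin nB → Fin 2)) ℂ}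
    (hM : M.IsHermitian) :
    ‖pauliComb a - M‖ ^ 2 = 2 ^ (nA + nB) * ∑ x, a x ^ 2 + (M * M).trace.re
      - 2 * ∑ x, a x * (pauliPair x * M).trace.re := by
  rw [((pauliComb_isHermitian a).sub hM).frobenius_norm_sq, mul_sub, sub_mul, sub_mul, trace_sub,
    trace_sub, trace_sub, trace_mul_comm M (pauliComb a), ← trace_pauliComb_mul_self_re,
    ← trace_pauliComb_mul_re]
  simp only [Complex.sub_re]
  ring

/-- The quadratic penalty is a sum of squared Frobenius distances. -/
lemma penalty_eq_sum_norm_sq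
    {ρ S T : Matrix ((Fin nA → Fin 2) × (Fin nB → Fin 2))
      ((Fin nA → Fin 2) × (Fin nB → Fin 2)) ℂ}
    (hρ : ρ.IsHermitian) (hS : S.IsHermitian) (hT : T.IsHermitian)
    (α β : (Fin nA → Fin 4) → (Fin nB → Fin 4) → ℝ) (lam mu : ℝ) :
    (2:ℝ)^(nA + nB + 1) * ((∑ xA, ∑ xB, (α xA xB)^2) + (∑ xA, ∑ xB, (β xA xB)^2))
        + ((ρ * ρ).trace.re) + mu^2 * ((T * T).trace.re)
        - 2 * ∑ xA, ∑ xB, (-1:ℝ)^(countY xB) * (α xA xB - β xA xB) *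
            (((pauliString xA ⊗ₖ pauliString xB) * ρ).trace.re)
        - (2:ℝ)^(nA + nB + 1) * ∑ xA, ∑ xB, α xA xB * β xA xB
        + lam^2 * ((S * S).trace.re)
        - 2 * lam * ∑ xA, ∑ xB, α xA xB * (((pauliString xA ⊗ₖ pauliString xB) * S).trace.re)
        - 2 * mu * ∑ xA, ∑ xB, β xA xB * (((pauliString xA ⊗ₖ pauliString xB) * T).trace.re)
      = ‖ptB (pauliComb (α.uncurry) - pauliComb (β.uncurry)) - ρ‖ ^ 2
        + ‖pauliComb (α.uncurry) - (lam : ℂ) • S‖ ^ 2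
        + ‖pauliComb (β.uncurry) - (mu : ℂ) • T‖ ^ 2 := by
  have hsmul {c : ℝ} {M : Matrix ((Fin nA → Fin 2) × (Fin nB → Fin 2))
      ((Fin nA → Fin 2) × (Fin nB → Fin 2)) ℂ} (hM : M.IsHermitian) :
      ((c : ℂ) • M).IsHermitian := by
    simp [IsHermitian, conjTranspose_smul, hM.eq]
  rw [← pauliComb_sub, ptB_pauliComb, norm_pauliComb_sub_sq _ hρ,
    norm_pauliComb_sub_sq _ (hsmul hS), norm_pauliComb_sub_sq _ (hsmul hT)]
  have hsq (x : (Fin nA → Fin 4) × (Fin nB → Fin 4)) :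
      ((-1 : ℝ) ^ countY x.2 * (α.uncurry - β.uncurry) x) ^ 2 =
        α.uncurry x ^ 2 + β.uncurry x ^ 2 - 2 * (α.uncurry x * β.uncurry x) := by
    rw [mul_pow, ← pow_mul, mul_comm (countY _), pow_mul, neg_one_sq, one_pow, one_mul,
      Pi.sub_apply]
    ring
  simp only [hsq]
  simp only [Finset.sum_sub_distrib, Finset.sum_add_distrib, ← Finset.mul_sum, Matrix.smul_mul,
    Matrix.mul_smul, trace_smul, smul_eq_mul, Complex.re_ofReal_mul, mul_left_comm _ lam,
    mul_left_comm _ mu]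
  simp only [Fintype.sum_prod_type, pauliPair, Function.uncurry_apply_pair, Pi.sub_apply]
  ring

end PauliPair

section Dual

variable {ιA ιB : Type*} [Fintype ιA] [Fintype ιB] [DecidableEq ιA] [DecidableEq ιB]

/-- An approximately feasible pair for the negativity dual program, approximately positive
semidefinite, can be repaired to a feasible one at a cost linear in the violations. -/
lemma exists_feasible_trace_le {ρ A B S T : Matrix (ιA × ιB) (ιA × ιB) ℂ}
    (hρ : ρ.IsHermitian) (hA : A.IsHermitian) (hB : B.IsHermitian)
    (hS : S.PosSemidef) (hT : T.PosSemidef) :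
    ∃ K L : Matrix (ιA × ιB) (ιA × ιB) ℂ, K.PosSemidef ∧ L.PosSemidef ∧ ptB (K - L) = ρ ∧
      (K + L).trace.re ≤ A.trace.re + B.trace.re
        + 4 * Fintype.card (ιA × ιB) * (‖ptB (A - B) - ρ‖ + ‖A - S‖ + ‖B - T‖) := by
  set r : ℝ := ‖ptB (A - B) - ρ‖ + ‖A - S‖ + ‖B - T‖ with hr
  set H := S - T - ptB ρ with hH
  have hHherm : H.IsHermitian := (hS.1.sub hT.1).sub hρ.ptB
  have hHr : ‖H‖ ≤ r := by
    have hdecomp : H = ptB (ptB (A - B) - ρ) - (A - S) + (B - T) := by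
      rw [hH, ptB_sub, ptB_ptB]
      abel
    rw [hdecomp, hr, ← norm_ptB (ptB (A - B) - ρ)]
    exact (norm_add_le _ _).trans (by gcongr; exact norm_sub_le _ _)
  have hone : ((r : ℂ) • (1 : Matrix (ιA × ιB) (ιA × ιB) ℂ)).PosSemidef :=
    PosSemidef.one.smul (Complex.zero_le_real.mpr (by positivity))
  refine ⟨S + (r : ℂ) • 1, T + (H + (r : ℂ) • 1), hS.add hone,
    hT.add (hHherm.add_smul_one_posSemidef hHr), ?_, ?_⟩
  · rw [show S + (r : ℂ) • 1 - (T + (H + (r : ℂ) • 1)) = ptB ρ by rw [hH]; abel, ptB_ptB]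
  · have h1 := hHherm.trace_re_le
    have h2 := (hA.sub hS.1).neg_trace_re_le
    have h3 := (hB.sub hT.1).neg_trace_re_le
    simp only [trace_sub, Complex.sub_re] at h2 h3
    have hd : (0 : ℝ) ≤ Fintype.card (ιA × ιB) := by positivity
    have h4 := mul_le_mul_of_nonneg_left hHr hd
    have h5 : Fintype.card (ιA × ιB) * (‖A - S‖ + ‖B - T‖) ≤ Fintype.card (ιA × ιB) * r :=
      mul_le_mul_of_nonneg_left (by rw [hr]; linarith [norm_nonneg (ptB (A - B) - ρ)]) hd
    simp only [trace_add, trace_smul, trace_one, smul_eq_mul, Complex.add_re,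
      Complex.re_ofReal_mul, Complex.natCast_re]
    linarith

end Dual

lemma tendsto_of_eventually_le_and_le {X : Type*} {l : Filter X} {f g : X → ℝ} {a : ℝ}
    (hg : Tendsto g l (nhds a)) (h : ∀ᶠ x in l, g x ≤ f x ∧ f x ≤ a) : Tendsto f l (nhds a) :=
  tendsto_of_tendsto_of_tendsto_of_le_of_le' hg tendsto_const_nhds (h.mono fun _ => And.left)
    (h.mono fun _ => And.right)

theorem negativity_dual_qslack (nA nB : ℕ)
    (ρAB : Matrix ((Fin nA → Fin 2) × (Fin nB → Fin 2))
      ((Fin nA → Fin 2) × (Fin nB → Fin 2)) ℂ)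
    (hρAB : ρAB.PosSemidef ∧ ρAB.trace = 1) :
    Tendsto (fun c : ℝ =>
        sInf {v : ℝ | ∃ (α β : (Fin nA → Fin 4) → (Fin nB → Fin 4) → ℝ) (lam mu : ℝ)
            (σAB τAB : Matrix ((Fin nA → Fin 2) × (Fin nB → Fin 2))
              ((Fin nA → Fin 2) × (Fin nB → Fin 2)) ℂ),
          0 ≤ lam ∧ 0 ≤ mu ∧
          (σAB.PosSemidef ∧ σAB.trace = 1) ∧ (τAB.PosSemidef ∧ τAB.trace = 1) ∧
          v = (2:ℝ)^(nA + nB) * (α (fun _ => 0) (fun _ => 0) + β (fun _ => 0) (fun _ => 0))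
            + c * ((2:ℝ)^(nA + nB + 1) *
                ((∑ xA, ∑ xB, (α xA xB)^2) + (∑ xA, ∑ xB, (β xA xB)^2))
              + ((ρAB * ρAB).trace.re) + mu^2 * ((τAB * τAB).trace.re)
              - 2 * ∑ xA, ∑ xB, (-1:ℝ)^(countY xB) * (α xA xB - β xA xB) *
                  (((pauliString xA ⊗ₖ pauliString xB) * ρAB).trace.re)
              - (2:ℝ)^(nA + nB + 1) * ∑ xA, ∑ xB, α xA xB * β xA xB
              + lam^2 * ((σAB * σAB).trace.re)
              - 2 * lam * ∑ xA, ∑ xB, α xA xB *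
                  (((pauliString xA ⊗ₖ pauliString xB) * σAB).trace.re)
              - 2 * mu * ∑ xA, ∑ xB, β xA xB *
                  (((pauliString xA ⊗ₖ pauliString xB) * τAB).trace.re))})
      atTop
      (nhds (sInf {v : ℝ | ∃ K L : Matrix ((Fin nA → Fin 2) × (Fin nB → Fin 2))
          ((Fin nA → Fin 2) × (Fin nB → Fin 2)) ℂ,
        K.PosSemidef ∧ L.PosSemidef ∧ ptB (K - L) = ρAB ∧
        v = (((K + L).trace).re)})) := by
  set P : Set ℝ := {v : ℝ | ∃ K L : Matrix ((Fin nA → Fin 2) × (Fin nB → Fin 2))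
      ((Fin nA → Fin 2) × (Fin nB → Fin 2)) ℂ,
    K.PosSemidef ∧ L.PosSemidef ∧ ptB (K - L) = ρAB ∧ v = (((K + L).trace).re)} with hP
  have hρ : ρAB.IsHermitian := hρAB.1.1
  have hPbdd : BddBelow P := by
    refine ⟨0, ?_⟩
    rintro v ⟨K, L, hK, hL, -, rfl⟩
    exact (Complex.le_def.mp (hK.add hL).trace_nonneg).1
  have hPne : P.Nonempty := by
    obtain ⟨K, L, hK, hL, h, -⟩ := exists_feasible_trace_le hρ isHermitian_zero isHermitian_zero
      PosSemidef.zero PosSemidef.zero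
    exact ⟨_, K, L, hK, hL, h, rfl⟩
  set d : ℝ := (Fintype.card ((Fin nA → Fin 2) × (Fin nB → Fin 2)) : ℝ) with hd
  have hlim : Tendsto (fun c : ℝ => sInf P - 12 * d ^ 2 / c) atTop (nhds (sInf P)) := by
    have h : Tendsto (fun c : ℝ => 12 * d ^ 2 / c) atTop (nhds 0) :=
      tendsto_const_nhds.div_atTop tendsto_id
    simpa using h.const_sub (sInf P)
  have hobj (a b : (Fin nA → Fin 4) → (Fin nB → Fin 4) → ℝ) :
      (2:ℝ)^(nA + nB) * (a (fun _ => 0) (fun _ => 0) + b (fun _ => 0) (fun _ => 0)) =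
        (pauliComb a.uncurry).trace.re + (pauliComb b.uncurry).trace.re := by
    simp only [trace_pauliComb_re, Function.uncurry_apply_pair]
    ring
  refine tendsto_of_eventually_le_and_le hlim ?_
  filter_upwards [eventually_gt_atTop 0] with c hc
  set F : Set ℝ := {v : ℝ | _} with hF
  have hsub : P ⊆ F := by
    rintro v ⟨K, L, hK, hL, hKL, rfl⟩
    obtain ⟨a, ha⟩ := hK.1.exists_pauliComb_eq
    obtain ⟨b, hb⟩ := hL.1.exists_pauliComb_eq
    obtain ⟨lam, σ, hlam, hσ, hKσ⟩ := hK.exists_smul_density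
    obtain ⟨mu, τ, hmu, hτ, hLτ⟩ := hL.exists_smul_density
    refine ⟨Function.curry a, Function.curry b, lam, mu, σ, τ, hlam, hmu, hσ, hτ, ?_⟩
    rw [penalty_eq_sum_norm_sq hρ hσ.1.1 hτ.1.1, hobj, Function.uncurry_curry,
      Function.uncurry_curry, ha, hb, hKL, ← hKσ, ← hLτ]
    simp
  have hlow : ∀ v ∈ F, sInf P - 12 * d ^ 2 / c ≤ v := by
    rintro v ⟨a, b, lam, mu, σ, τ, hlam, hmu, hσ, hτ, rfl⟩
    rw [penalty_eq_sum_norm_sq hρ hσ.1.1 hτ.1.1, hobj]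
    obtain ⟨K, L, hK, hL, hKL, hle⟩ := exists_feasible_trace_le hρ
      (pauliComb_isHermitian a.uncurry) (pauliComb_isHermitian b.uncurry)
      (hσ.1.smul (Complex.zero_le_real.mpr hlam)) (hτ.1.smul (Complex.zero_le_real.mpr hmu))
    have hPle : sInf P ≤ (K + L).trace.re := csInf_le hPbdd ⟨K, L, hK, hL, hKL, rfl⟩
    have hamgm (e : ℝ) : 4 * d * e ≤ c * e ^ 2 + 4 * d ^ 2 / c := by
      have h : c * e ^ 2 + 4 * d ^ 2 / c - 4 * d * e = (c * e - 2 * d) ^ 2 / c := by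
        field_simp
        ring
      have : 0 ≤ (c * e - 2 * d) ^ 2 / c := by positivity
      linarith
    have h1 := hamgm ‖ptB (pauliComb a.uncurry - pauliComb b.uncurry) - ρAB‖
    have h2 := hamgm ‖pauliComb a.uncurry - (lam : ℂ) • σ‖
    have h3 := hamgm ‖pauliComb b.uncurry - (mu : ℂ) • τ‖
    have h4 : 12 * d ^ 2 / c = 3 * (4 * d ^ 2 / c) := by ring
    rw [← hd] at hle
    linarith
  exact ⟨le_csInf (hPne.mono hsub) hlow, csInf_le_csInf ⟨_, hlow⟩ hPne hsub⟩
end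
end

section
/- Let H, A₁, …, A_ℓ be 2^n×2^n Hermitian complex matrices and b₁, …, b_ℓ ∈ ℝ, and suppose there exists a 2^n×2^n density matrix ρ with Re Tr[A_i ρ] ≥ b_i for all i ∈ {1,…,ℓ}. Then lim_{c→∞} sInf {Re Tr[Hρ] + c·Σ_{i=1}^{ℓ} (Re Tr[A_i ρ] − b_i − z_i)² : ρ a 2^n×2^n density matrix, z₁, …, z_ℓ ≥ 0} = sInf {Re Tr[Hρ] : ρ a 2^n×2^n density matrix with Re Tr[A_i ρ] ≥ b_i for all i ∈ {1,…,ℓ}}. -/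
open Matrix Filter
open scoped ComplexOrder

noncomputable section

/-- A penalty term on a compact set pushes the penalized objective above every level below the
constrained lower bound, uniformly on the compact set. -/
theorem IsCompact.eventually_forall_lt_add_mul_penalty {X : Type*} [TopologicalSpace X]
    {K : Set X} (hK : IsCompact K) {f p : X → ℝ} (hf : Continuous f) (hp : Continuous p)
    (hp0 : ∀ x, 0 ≤ p x) {m a : ℝ} (hm : ∀ x ∈ K, p x = 0 → m ≤ f x) (ha : a < m) :
    ∀ᶠ c : ℝ in atTop, ∀ x ∈ K, a < f x + c * p x := by
  have mono {x : X} {c d : ℝ} (hcd : c ≤ d) (h : a < f x + c * p x) : a < f x + d * p x :=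
    h.trans_le (by gcongr; exact hp0 x)
  obtain ⟨c, hc⟩ := hK.elim_directed_cover (fun c : ℝ => {x | a < f x + c * p x})
    (fun c => isOpen_lt continuous_const (by fun_prop))
    (fun x hx => by
      rw [Set.mem_iUnion]
      rcases (hp0 x).eq_or_lt with h | h
      · exact ⟨0, by simpa using ha.trans_le (hm x hx h.symm)⟩
      · refine ⟨(a - f x + 1) / p x, ?_⟩
        rw [Set.mem_ofPred_eq, div_mul_cancel₀ _ h.ne']
        linarith)
    (directed_of_isDirected_le fun c d hcd x hx => mono hcd hx)
  filter_upwards [eventually_ge_atTop c] with d hd x hx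
  exact mono hd (hc hx)

open scoped MatrixOrder in
/-- The set of density matrices is compact. -/
theorem isCompact_setOf_posSemidef_trace_eq_one (ι : Type*) [Fintype ι] :
    IsCompact {ρ : Matrix ι ι ℂ | ρ.PosSemidef ∧ ρ.trace = 1} := by
  classical
  have hball : IsCompact (Set.univ.pi fun _ : ι => Set.univ.pi fun _ : ι =>
      Metric.closedBall (0 : ℂ) 1) :=
    isCompact_univ_pi fun _ => isCompact_univ_pi fun _ => isCompact_closedBall _ _
  have hfac : IsCompact {B : Matrix ι ι ℂ | (Bᴴ * B).trace = 1} := by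
    refine hball.of_isClosed_subset (isClosed_eq (by fun_prop) continuous_const) ?_
    intro (B : Matrix ι ι ℂ) hB i _ j _
    have hsum : ∑ k, ∑ l, ‖B l k‖ ^ 2 = 1 := by
      have h : (Bᴴ * B).trace = 1 := hB
      simp only [trace, diag_apply, mul_apply, conjTranspose_apply, Complex.star_def,
        Complex.conj_mul'] at h
      exact_mod_cast h
    have hle : ‖B i j‖ ^ 2 ≤ 1 := by
      rw [← hsum]
      exact (Finset.single_le_sum (f := fun l => ‖B l j‖ ^ 2) (fun _ _ => sq_nonneg _)
        (Finset.mem_univ i)).trans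
        (Finset.single_le_sum (f := fun k => ∑ l, ‖B l k‖ ^ 2)
          (fun _ _ => Finset.sum_nonneg fun _ _ => sq_nonneg _) (Finset.mem_univ j))
    rw [mem_closedBall_zero_iff]
    exact (sq_le_one_iff₀ (norm_nonneg _)).mp hle
  convert hfac.image (f := fun B => Bᴴ * B) (by fun_prop) using 1
  ext ρ
  constructor
  · rintro ⟨hρ, htr⟩
    obtain ⟨B, rfl⟩ := CStarAlgebra.nonneg_iff_eq_star_mul_self.mp hρ.nonneg
    exact ⟨B, htr, rfl⟩
  · rintro ⟨B, hB, rfl⟩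
    exact ⟨posSemidef_conjTranspose_mul_self B, hB⟩

/-- The squared violation of the constraint `0 ≤ t` is the least squared distance from `t` to a
nonnegative slack. -/
theorem sq_min_zero_le_sq_sub {t z : ℝ} (hz : 0 ≤ z) : (min t 0) ^ 2 ≤ (t - z) ^ 2 := by
  rcases le_total t 0 with h | h
  · rw [min_eq_left h]
    nlinarith
  · rw [min_eq_right h]
    nlinarith [sq_nonneg (t - z)]

theorem constrained_hamiltonian_primal_qslack (n ℓ : ℕ)
    (H : Matrix (Fin (2^n)) (Fin (2^n)) ℂ) (hH : H.IsHermitian)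
    (A : Fin ℓ → Matrix (Fin (2^n)) (Fin (2^n)) ℂ) (hA : ∀ i, (A i).IsHermitian)
    (b : Fin ℓ → ℝ)
    (hfeas : ∃ ρ : Matrix (Fin (2^n)) (Fin (2^n)) ℂ,
      ρ.PosSemidef ∧ ρ.trace = 1 ∧ ∀ i, b i ≤ ((A i * ρ).trace).re) :
    Tendsto (fun c : ℝ =>
        sInf {v : ℝ | ∃ (ρ : Matrix (Fin (2^n)) (Fin (2^n)) ℂ) (z : Fin ℓ → ℝ),
          ρ.PosSemidef ∧ ρ.trace = 1 ∧ (∀ i, 0 ≤ z i) ∧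
          v = ((H * ρ).trace).re + c * ∑ i, (((A i * ρ).trace).re - b i - z i)^2})
      atTop
      (nhds (sInf {v : ℝ | ∃ ρ : Matrix (Fin (2^n)) (Fin (2^n)) ℂ,
        ρ.PosSemidef ∧ ρ.trace = 1 ∧ (∀ i, b i ≤ ((A i * ρ).trace).re) ∧
        v = ((H * ρ).trace).re})) := by
  set S := {v : ℝ | ∃ ρ : Matrix (Fin (2^n)) (Fin (2^n)) ℂ,
    ρ.PosSemidef ∧ ρ.trace = 1 ∧ (∀ i, b i ≤ ((A i * ρ).trace).re) ∧
    v = ((H * ρ).trace).re} with hS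
  have hK := isCompact_setOf_posSemidef_trace_eq_one (Fin (2 ^ n))
  have hcont (M : Matrix (Fin (2^n)) (Fin (2^n)) ℂ) :
      Continuous fun ρ : Matrix (Fin (2^n)) (Fin (2^n)) ℂ => ((M * ρ).trace).re := by
    fun_prop
  have hSne : S.Nonempty := by
    obtain ⟨ρ, hρ, htr, hb⟩ := hfeas
    exact ⟨_, ρ, hρ, htr, hb, rfl⟩
  have hSbdd : BddBelow S := by
    refine (hK.image (hcont H)).bddBelow.mono ?_
    rintro v ⟨ρ, hρ, htr, -, rfl⟩
    exact ⟨ρ, ⟨hρ, htr⟩, rfl⟩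
  have hlow : ∀ a < sInf S, ∀ᶠ c : ℝ in atTop,
      ∀ (ρ : Matrix (Fin (2^n)) (Fin (2^n)) ℂ) (z : Fin ℓ → ℝ),
        ρ.PosSemidef → ρ.trace = 1 → (∀ i, 0 ≤ z i) →
        a < ((H * ρ).trace).re + c * ∑ i, (((A i * ρ).trace).re - b i - z i)^2 := by
    intro a ha
    have hpen := hK.eventually_forall_lt_add_mul_penalty (hcont H)
      (p := fun ρ => ∑ i, (min (((A i * ρ).trace).re - b i) 0) ^ 2)
      (continuous_finsetSum _ fun i _ =>
        (((hcont (A i)).sub continuous_const).min continuous_const).pow 2)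
      (fun ρ => Finset.sum_nonneg fun i _ => sq_nonneg _)
      (fun ρ hρ h0 => csInf_le hSbdd ⟨ρ, hρ.1, hρ.2, fun i => by
        rw [Finset.sum_eq_zero_iff_of_nonneg fun i _ => sq_nonneg _] at h0
        have hi := min_eq_right_iff.mp ((pow_eq_zero_iff two_ne_zero).mp
          (h0 i (Finset.mem_univ i)))
        linarith, rfl⟩) ha
    filter_upwards [hpen, eventually_ge_atTop 0] with c hc hc0 ρ z hρ htr hz
    refine (hc ρ ⟨hρ, htr⟩).trans_le ?_
    gcongr _ + c * ∑ i, ?_ with i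
    exact sq_min_zero_le_sq_sub (hz i)
  refine tendsto_order.mpr ⟨fun a ha => ?_, fun a ha => ?_⟩
  · obtain ⟨a', haa', ha'⟩ := exists_between ha
    filter_upwards [hlow a' ha'] with c hc
    refine haa'.trans_le (le_csInf ?_ ?_)
    · obtain ⟨ρ, hρ, htr, -⟩ := hfeas
      exact ⟨_, ρ, 0, hρ, htr, fun _ => le_rfl, rfl⟩
    · rintro v ⟨ρ, z, hρ, htr, hz, rfl⟩
      exact (hc ρ z hρ htr hz).le
  · filter_upwards [hlow (sInf S - 1) (by linarith)] with c hc
    refine (csInf_le_csInf ⟨sInf S - 1, ?_⟩ hSne ?_).trans_lt ha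
    · rintro v ⟨ρ, z, hρ, htr, hz, rfl⟩
      exact (hc ρ z hρ htr hz).le
    · rintro v ⟨ρ, hρ, htr, hb, rfl⟩
      exact ⟨ρ, fun i => ((A i * ρ).trace).re - b i, hρ, htr, fun i => sub_nonneg.mpr (hb i),
        by simp⟩
end
end

section
/- Let H, A₁, …, A_ℓ be 2^n×2^n Hermitian complex matrices and b₁, …, b_ℓ ∈ ℝ, and suppose there exists a 2^n×2^n density matrix ρ with Re Tr[A_i ρ] ≥ b_i for all i ∈ {1,…,ℓ}. Then lim_{c→∞} sSup {Σ_{i=1}^{ℓ} b_i y_i + μ − c·‖H − Σ_{i=1}^{ℓ} y_i A_i − μ I − ν ω‖₂² : y₁, …, y_ℓ ≥ 0, μ ∈ ℝ, ν ≥ 0, ω a 2^n×2^n density matrix} = sSup {Σ_{i=1}^{ℓ} b_i y_i + μ : y₁, …, y_ℓ ≥ 0, μ ∈ ℝ, H − Σ_{i=1}^{ℓ} y_i A_i − μ I positive semidefinite}. -/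
open Matrix Filter
open scoped ComplexOrder

noncomputable section

namespace Matrix

variable {ι : Type*}

lemma isHermitian_real_smul {A : Matrix ι ι ℂ} (hA : A.IsHermitian) (r : ℝ) :
    (r • A).IsHermitian := by
  rw [IsHermitian, conjTranspose_smul, hA.eq, star_trivial]

variable [Fintype ι]

open scoped MatrixOrder in
lemma PosSemidef.re_trace_mul_nonneg {A B : Matrix ι ι ℂ} (hA : A.PosSemidef)
    (hB : B.PosSemidef) : 0 ≤ (A * B).trace.re := by
  classical
  obtain ⟨C, rfl⟩ := CStarAlgebra.nonneg_iff_eq_star_mul_self.mp hB.nonneg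
  rw [← mul_assoc, trace_mul_comm, ← mul_assoc]
  exact (Complex.nonneg_iff.mp (hA.mul_mul_conjTranspose_same C).trace_nonneg).1

variable [DecidableEq ι]

lemma IsHermitian.trace_conjTranspose_mul_self_re {A : Matrix ι ι ℂ} (hA : A.IsHermitian) :
    (Aᴴ * A).trace.re = ∑ i, hA.eigenvalues i ^ 2 := by
  rw [hA.eq]
  conv_lhs => rw [hA.spectral_theorem, ← map_mul, Unitary.conjStarAlgAut_apply,
    trace_mul_comm, ← mul_assoc, Unitary.coe_star_mul_self, one_mul, diagonal_mul_diagonal,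
    trace_diagonal]
  simp [sq]

lemma IsHermitian.posSemidef_add_hsNorm_smul_one_s15 {A : Matrix ι ι ℂ} (hA : A.IsHermitian) :
    (A + hsNorm A • (1 : Matrix ι ι ℂ)).PosSemidef := by
  set t := hsNorm A
  have hbound : ∀ i, 0 ≤ hA.eigenvalues i + t := by
    intro i
    have h : |hA.eigenvalues i| ≤ t := by
      refine Real.abs_le_sqrt ?_
      rw [hA.trace_conjTranspose_mul_self_re]
      exact Finset.single_le_sum (f := fun j => hA.eigenvalues j ^ 2)
        (fun j _ => sq_nonneg _) (Finset.mem_univ i)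
    linarith [neg_abs_le (hA.eigenvalues i)]
  have hD : (diagonal fun i => ((hA.eigenvalues i + t : ℝ) : ℂ)).PosSemidef :=
    PosSemidef.diagonal fun i => Complex.zero_le_real.mpr (hbound i)
  have key : A + t • (1 : Matrix ι ι ℂ) = Unitary.conjStarAlgAut ℂ _ hA.eigenvectorUnitary
      (diagonal fun i => ((hA.eigenvalues i + t : ℝ) : ℂ)) := by
    have hsplit : (diagonal fun i => ((hA.eigenvalues i + t : ℝ) : ℂ)) =
        diagonal (RCLike.ofReal ∘ hA.eigenvalues) + (t : ℂ) • (1 : Matrix ι ι ℂ) := by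
      rw [← diagonal_one, ← diagonal_smul, diagonal_add]
      congr 1
      ext i
      simp
    rw [hsplit, map_add, map_smul, map_one, ← hA.spectral_theorem, Complex.coe_smul]
  rw [key, Unitary.conjStarAlgAut_apply]
  exact hD.mul_mul_conjTranspose_same _

end Matrix

lemma hsNorm_zero {ι : Type*} [Fintype ι] : hsNorm (0 : Matrix ι ι ℂ) = 0 := by
  simp [hsNorm]

/-- A positive semidefinite matrix is a nonnegative multiple of a density matrix, as soon as
density matrices exist. -/
lemma Matrix.PosSemidef.exists_smul_density_s15 {ι : Type*} [Fintype ι] {W ρ : Matrix ι ι ℂ}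
    (hW : W.PosSemidef) (hρ : ρ.PosSemidef) (hρ1 : ρ.trace = 1) :
    ∃ (ν : ℝ) (ω : Matrix ι ι ℂ), 0 ≤ ν ∧ ω.PosSemidef ∧ ω.trace = 1 ∧ W = ν • ω := by
  classical
  obtain ⟨h0, him⟩ := Complex.nonneg_iff.mp hW.trace_nonneg
  have htr : (W.trace.re : ℂ) = W.trace := Complex.ext rfl (by simpa using him)
  rcases eq_or_ne W.trace.re 0 with h | h
  · refine ⟨0, ρ, le_rfl, hρ, hρ1, ?_⟩
    rw [zero_smul, ← hW.trace_eq_zero_iff, ← htr, h, Complex.ofReal_zero]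
  · refine ⟨W.trace.re, W.trace.re⁻¹ • W, h0, ?_, ?_, ?_⟩
    · exact hW.smul (inv_nonneg.mpr h0)
    · rw [trace_smul, Complex.real_smul, ← htr, Complex.ofReal_re, ← Complex.ofReal_mul,
        inv_mul_cancel₀ h, Complex.ofReal_one]
    · rw [smul_smul, mul_inv_cancel₀ h, one_smul]

/-- Weak duality for constrained Hamiltonian optimization. -/
lemma constrained_hamiltonian_weak_duality {ι κ : Type*} [Fintype ι] [DecidableEq ι] [Fintype κ]
    {H ρ : Matrix ι ι ℂ} {A : κ → Matrix ι ι ℂ} {b y : κ → ℝ} {μ : ℝ}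
    (hρ : ρ.PosSemidef) (hρ1 : ρ.trace = 1) (hb : ∀ i, b i ≤ (A i * ρ).trace.re)
    (hy : ∀ i, 0 ≤ y i)
    (hpos : (H - (∑ i, y i • A i) - μ • (1 : Matrix ι ι ℂ)).PosSemidef) :
    (∑ i, b i * y i) + μ ≤ (H * ρ).trace.re := by
  have h := hpos.re_trace_mul_nonneg hρ
  have hsum : ∑ i, b i * y i ≤ ∑ i, y i * (A i * ρ).trace.re :=
    Finset.sum_le_sum fun i _ => by
      rw [mul_comm]
      exact mul_le_mul_of_nonneg_left (hb i) (hy i)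
  simp only [sub_mul, Finset.sum_mul, smul_mul_assoc, one_mul, trace_sub, trace_sum, trace_smul,
    hρ1, Complex.sub_re, Complex.re_sum, Complex.smul_re, Complex.one_re, smul_eq_mul,
    mul_one] at h
  linarith

theorem constrained_hamiltonian_dual_qslack (n ℓ : ℕ)
    (H : Matrix (Fin (2^n)) (Fin (2^n)) ℂ) (hH : H.IsHermitian)
    (A : Fin ℓ → Matrix (Fin (2^n)) (Fin (2^n)) ℂ) (hA : ∀ i, (A i).IsHermitian)
    (b : Fin ℓ → ℝ)
    (hfeas : ∃ ρ : Matrix (Fin (2^n)) (Fin (2^n)) ℂ,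
      ρ.PosSemidef ∧ ρ.trace = 1 ∧ ∀ i, b i ≤ ((A i * ρ).trace).re) :
    Tendsto (fun c : ℝ =>
        sSup {v : ℝ | ∃ (y : Fin ℓ → ℝ) (μ ν : ℝ)
            (ω : Matrix (Fin (2^n)) (Fin (2^n)) ℂ),
          (∀ i, 0 ≤ y i) ∧ 0 ≤ ν ∧ ω.PosSemidef ∧ ω.trace = 1 ∧
          v = (∑ i, b i * y i) + μ - c *
            (hsNorm (H - (∑ i, y i • A i) - μ • (1 : Matrix (Fin (2^n)) (Fin (2^n)) ℂ)
              - ν • ω))^2})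
      atTop
      (nhds (sSup {v : ℝ | ∃ (y : Fin ℓ → ℝ) (μ : ℝ),
        (∀ i, 0 ≤ y i) ∧
        (H - (∑ i, y i • A i) - μ • (1 : Matrix (Fin (2^n)) (Fin (2^n)) ℂ)).PosSemidef ∧
        v = (∑ i, b i * y i) + μ})) := by
  obtain ⟨ρ, hρ, hρ1, hb⟩ := hfeas
  set D := {v : ℝ | ∃ (y : Fin ℓ → ℝ) (μ : ℝ),
    (∀ i, 0 ≤ y i) ∧
    (H - (∑ i, y i • A i) - μ • (1 : Matrix (Fin (2^n)) (Fin (2^n)) ℂ)).PosSemidef ∧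
    v = (∑ i, b i * y i) + μ}
  have hDbdd : BddAbove D := by
    refine ⟨(H * ρ).trace.re, ?_⟩
    rintro v ⟨y, μ, hy, hpos, rfl⟩
    exact constrained_hamiltonian_weak_duality hρ hρ1 hb hy hpos
  have hDne : D.Nonempty := by
    refine ⟨_, 0, -hsNorm H, fun _ => le_rfl, ?_, rfl⟩
    simpa using hH.posSemidef_add_hsNorm_smul_one_s15
  set F : ℝ → Set ℝ := fun c => {v : ℝ | ∃ (y : Fin ℓ → ℝ) (μ ν : ℝ)
      (ω : Matrix (Fin (2^n)) (Fin (2^n)) ℂ),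
    (∀ i, 0 ≤ y i) ∧ 0 ≤ ν ∧ ω.PosSemidef ∧ ω.trace = 1 ∧
    v = (∑ i, b i * y i) + μ - c *
      (hsNorm (H - (∑ i, y i • A i) - μ • (1 : Matrix (Fin (2^n)) (Fin (2^n)) ℂ)
        - ν • ω))^2}
  have hDF : ∀ c, D ⊆ F c := by
    rintro c v ⟨y, μ, hy, hpos, rfl⟩
    obtain ⟨ν, ω, hν, hω, hω1, hW⟩ := hpos.exists_smul_density_s15 hρ hρ1
    refine ⟨y, μ, ν, ω, hy, hν, hω, hω1, ?_⟩
    rw [hW, sub_self, hsNorm_zero]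
    ring
  have hFle : ∀ c, 0 < c → ∀ v ∈ F c, v ≤ sSup D + 1 / (4 * c) := by
    rintro c hc v ⟨y, μ, ν, ω, hy, hν, hω, -, rfl⟩
    set E := H - (∑ i, y i • A i) - μ • (1 : Matrix (Fin (2^n)) (Fin (2^n)) ℂ) - ν • ω with hEdef
    have hE : E.IsHermitian :=
      ((hH.sub (isSelfAdjoint_sum _ fun i _ => isHermitian_real_smul (hA i) (y i))).sub
        (isHermitian_real_smul isHermitian_one μ)).sub (isHermitian_real_smul hω.isHermitian ν)
    have hmem : (∑ i, b i * y i) + (μ - hsNorm E) ∈ D := by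
      refine ⟨y, μ - hsNorm E, hy, ?_, rfl⟩
      have hshift : H - (∑ i, y i • A i)
          - (μ - hsNorm E) • (1 : Matrix (Fin (2^n)) (Fin (2^n)) ℂ)
          = E + hsNorm E • (1 : Matrix (Fin (2^n)) (Fin (2^n)) ℂ) + ν • ω := by
        rw [sub_smul]
        nth_rewrite 2 [hEdef]
        abel
      rw [hshift]
      exact hE.posSemidef_add_hsNorm_smul_one_s15.add (hω.smul hν)
    have hle := le_csSup hDbdd hmem
    have hquad : hsNorm E - c * hsNorm E ^ 2 ≤ 1 / (4 * c) := by
      rw [le_div_iff₀ (by positivity)]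
      nlinarith [sq_nonneg (2 * c * hsNorm E - 1)]
    linarith
  have hlim : Tendsto (fun c : ℝ => sSup D + 1 / (4 * c)) atTop (nhds (sSup D)) := by
    have h : Tendsto (fun c : ℝ => 1 / (4 * c)) atTop (nhds 0) := by
      simp only [one_div]
      exact (tendsto_id.const_mul_atTop (by norm_num : (0 : ℝ) < 4)).inv_tendsto_atTop
    simpa using tendsto_const_nhds.add h
  refine tendsto_of_tendsto_of_tendsto_of_le_of_le' tendsto_const_nhds hlim ?_ ?_
  · filter_upwards [eventually_gt_atTop 0] with c hc
    exact csSup_le_csSup ⟨_, hFle c hc⟩ hDne (hDF c)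
  · filter_upwards [eventually_gt_atTop 0] with c hc
    exact csSup_le (hDne.mono (hDF c)) (hFle c hc)
end
end

section
/- Let p and q be probability vectors in ℝ^{2^n}. Define, for each c > 0, g(c) = sInf {λ + c·‖λ r − p + q − μ s‖₂² : λ ≥ 0, μ ≥ 0, r and s probability vectors in ℝ^{2^n}}, where ‖·‖₂ is the Euclidean norm. Then lim_{c→∞} g(c) = sInf {Σ_x y_x : y ∈ ℝ^{2^n}, y ≥ 0 entrywise, y ≥ p − q entrywise}. -/
open Filter

noncomputable section

/-- The Euclidean norm of a real vector. -/
def euclNorm {ι : Type*} [Fintype ι] (v : ι → ℝ) : ℝ :=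
  Real.sqrt (∑ i, (v i)^2)

theorem euclNorm_sq {ι : Type*} [Fintype ι] (v : ι → ℝ) : euclNorm v ^ 2 = ∑ i, v i ^ 2 :=
  Real.sq_sqrt (Finset.sum_nonneg fun _ _ => sq_nonneg _)

/-- A nonnegative vector is its total mass times a probability vector; the probability vector `p`
serves only to handle the zero vector. -/
theorem exists_sum_smul_eq_of_nonneg {ι : Type*} [Fintype ι] {p y : ι → ℝ}
    (hp : (∀ i, 0 ≤ p i) ∧ ∑ i, p i = 1) (hy : ∀ i, 0 ≤ y i) :
    ∃ r : ι → ℝ, ((∀ i, 0 ≤ r i) ∧ ∑ i, r i = 1) ∧ (∑ i, y i) • r = y := by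
  by_cases h : ∑ i, y i = 0
  · refine ⟨p, hp, ?_⟩
    have hz := (Finset.sum_eq_zero_iff_of_nonneg fun i _ => hy i).1 h
    ext i
    simp [h, hz i (Finset.mem_univ i)]
  · refine ⟨(∑ i, y i)⁻¹ • y, ⟨fun i => ?_, ?_⟩, smul_inv_smul₀ h y⟩
    · exact mul_nonneg (inv_nonneg.2 (Finset.sum_nonneg fun i _ => hy i)) (hy i)
    · simp [← Finset.mul_sum, inv_mul_cancel₀ h]

theorem abs_le_mul_sq_add {c : ℝ} (hc : 0 < c) (x : ℝ) : |x| ≤ c * x ^ 2 + 1 / (4 * c) := by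
  have h : c * x ^ 2 + 1 / (4 * c) - |x| = (2 * c * |x| - 1) ^ 2 / (4 * c) := by
    rw [← sq_abs x]
    field_simp
    ring
  have : 0 ≤ (2 * c * |x| - 1) ^ 2 / (4 * c) := by positivity
  linarith

/-- Adding the absolute residual to `lam • r` makes it feasible for the dual program. -/
theorem sub_le_add_abs_residual {ι : Type*} {p q r s : ι → ℝ} {lam mu : ℝ} (hmu : 0 ≤ mu)
    (hs : ∀ i, 0 ≤ s i) (i : ι) :
    p i - q i ≤ lam * r i + |(lam • r - p + q - mu • s) i| := by
  have h := neg_abs_le ((lam • r - p + q - mu • s) i)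
  have h' := mul_nonneg hmu (hs i)
  simp only [Pi.sub_apply, Pi.add_apply, Pi.smul_apply, smul_eq_mul] at h ⊢
  linarith

theorem sum_add_abs_le_penalty {ι : Type*} [Fintype ι] {c lam : ℝ} {r : ι → ℝ} (hc : 0 < c)
    (hr : ∑ i, r i = 1) (e : ι → ℝ) :
    ∑ i, (lam * r i + |e i|) ≤ lam + c * euclNorm e ^ 2 + Fintype.card ι / (4 * c) := by
  have h := Finset.sum_le_sum fun i (_ : i ∈ Finset.univ) => abs_le_mul_sq_add hc (e i)
  rw [Finset.sum_add_distrib, ← Finset.mul_sum] at h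
  simp only [Finset.sum_const, Finset.card_univ, nsmul_eq_mul, mul_one_div] at h
  rw [Finset.sum_add_distrib, ← Finset.mul_sum, hr, euclNorm_sq]
  linarith

theorem tvd_dual_cslack (n : ℕ)
    (p q : Fin (2^n) → ℝ)
    (hp : (∀ i, 0 ≤ p i) ∧ ∑ i, p i = 1)
    (hq : (∀ i, 0 ≤ q i) ∧ ∑ i, q i = 1) :
    Tendsto (fun c : ℝ =>
        sInf {v : ℝ | ∃ (lam mu : ℝ) (r s : Fin (2^n) → ℝ),
          0 ≤ lam ∧ 0 ≤ mu ∧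
          ((∀ i, 0 ≤ r i) ∧ ∑ i, r i = 1) ∧ ((∀ i, 0 ≤ s i) ∧ ∑ i, s i = 1) ∧
          v = lam + c * (euclNorm (lam • r - p + q - mu • s))^2})
      atTop
      (nhds (sInf {v : ℝ | ∃ y : Fin (2^n) → ℝ,
        (∀ i, 0 ≤ y i) ∧ (∀ i, p i - q i ≤ y i) ∧ v = ∑ i, y i})) := by
  have key : ∀ y : Fin (2^n) → ℝ, (∀ i, 0 ≤ y i) → (∀ i, p i - q i ≤ y i) →
      ∃ r s : Fin (2^n) → ℝ, ((∀ i, 0 ≤ r i) ∧ ∑ i, r i = 1) ∧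
        ((∀ i, 0 ≤ s i) ∧ ∑ i, s i = 1) ∧
        (∑ i, y i) • r - p + q - (∑ i, y i) • s = 0 := by
    intro y hy hpq
    obtain ⟨r, hr, hry⟩ := exists_sum_smul_eq_of_nonneg hp hy
    obtain ⟨s, hs, hsy⟩ := exists_sum_smul_eq_of_nonneg (y := y - p + q) hp fun i => by
      simpa using by linarith [hpq i]
    have hsum : ∑ i, (y - p + q) i = ∑ i, y i := by
      simp [Finset.sum_add_distrib, hp.2, hq.2]
    rw [hsum] at hsy
    exact ⟨r, s, hr, hs, by rw [hry, hsy, sub_self]⟩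
  have hlim : Tendsto (fun c : ℝ => sInf {v : ℝ | ∃ y : Fin (2^n) → ℝ,
      (∀ i, 0 ≤ y i) ∧ (∀ i, p i - q i ≤ y i) ∧ v = ∑ i, y i} -
        Fintype.card (Fin (2^n)) / (4 * c)) atTop
      (nhds (sInf {v : ℝ | ∃ y : Fin (2^n) → ℝ,
        (∀ i, 0 ≤ y i) ∧ (∀ i, p i - q i ≤ y i) ∧ v = ∑ i, y i})) := by
    have h := tendsto_const_nhds (x := (Fintype.card (Fin (2^n)) : ℝ)) |>.div_atTop
      (tendsto_id.const_mul_atTop (zero_lt_four' ℝ))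
    simpa using h.const_sub _
  refine tendsto_of_tendsto_of_tendsto_of_le_of_le' hlim tendsto_const_nhds ?_ ?_
  · filter_upwards [eventually_gt_atTop 0] with c hc
    refine le_csInf ⟨_, 0, 0, p, p, le_rfl, le_rfl, hp, hp, rfl⟩ ?_
    rintro _ ⟨lam, mu, r, s, hlam, hmu, hr, hs, rfl⟩
    have hle := sum_add_abs_le_penalty (lam := lam) hc hr.2 (lam • r - p + q - mu • s)
    have hinf := csInf_le (s := {v : ℝ | ∃ y : Fin (2^n) → ℝ,
        (∀ i, 0 ≤ y i) ∧ (∀ i, p i - q i ≤ y i) ∧ v = ∑ i, y i})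
      ⟨0, by rintro _ ⟨y, hy, -, rfl⟩; exact Finset.sum_nonneg fun i _ => hy i⟩
      ⟨_, fun i => add_nonneg (mul_nonneg hlam (hr.1 i)) (abs_nonneg _),
        sub_le_add_abs_residual hmu hs.1, rfl⟩
    linarith
  · filter_upwards [eventually_gt_atTop 0] with c hc
    refine le_csInf ⟨_, p, hp.1, fun i => sub_le_self _ (hq.1 i), rfl⟩ ?_
    rintro _ ⟨y, hy, hpq, rfl⟩
    obtain ⟨r, s, hr, hs, h0⟩ := key y hy hpq
    have hsum : 0 ≤ ∑ i, y i := Finset.sum_nonneg fun i _ => hy i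
    refine csInf_le ⟨0, ?_⟩ ⟨_, _, r, s, hsum, hsum, hr, hs, ?_⟩
    · rintro _ ⟨lam, mu, r, s, hlam, -, -, -, rfl⟩
      positivity
    · rw [h0, euclNorm_sq]
      simp
end
end
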